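/- There exists a real number ρ > 0 with the following property: for every ε > 0 there exists N₀ such that for all N ≥ N₀, the number of primes p ≤ N with z(p) < N^{1/2}·e^{(log N)^ρ} is at most ε·π(N). -/

import Mathlib

/-- The order of appearance `z(k)`: the least positive integer `ℓ`
such that `k` divides the Fibonacci number `F_ℓ`. -/
noncomputable def orderOfAppearance (k : ℕ) : ℕ :=
  sInf {ℓ : ℕ | 0 < ℓ ∧ k ∣ Nat.fib ℓ}

section Helpers
open Finset Filter

lemma sum_le_sum_cover {α β : Type*} [DecidableEq α] [DecidableEq β] (s : Finset α) (t : Finset β) (f : α → ℝ)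
    (g : β → ℝ) (φ : β → α) (hg : ∀ b ∈ t, 0 ≤ g b)
    (h : ∀ a ∈ s, ∃ b ∈ t, φ b = a ∧ f a ≤ g b) : ∑ a ∈ s, f a ≤ ∑ b ∈ t, g b := by
  classical
  rcases s.eq_empty_or_nonempty with hs | ⟨a₀, ha₀⟩
  · subst hs
    simpa using Finset.sum_nonneg hg
  have : Nonempty β := ⟨(h a₀ ha₀).choose⟩
  choose! ψ h1 h2 h3 using h
  have hinj : Set.InjOn ψ (s : Set α) := by
    intro a ha b hb hab
    rw [← h2 a ha, ← h2 b hb, hab]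
  calc ∑ a ∈ s, f a ≤ ∑ a ∈ s, g (ψ a) := Finset.sum_le_sum h3
    _ = ∑ b ∈ s.image ψ, g b := (Finset.sum_image hinj).symm
    _ ≤ ∑ b ∈ t, g b := by
        apply Finset.sum_le_sum_of_subset_of_nonneg
        · intro b hb
          obtain ⟨a, ha, rfl⟩ := Finset.mem_image.1 hb
          exact h1 a ha
        · intro b hb _
          exact hg b hb

lemma sum_inv_sq_le_two (R : ℕ) : ∑ s ∈ Icc 1 R, (1 : ℝ) / (s : ℝ) ^ 2 ≤ 2 := by
  have key : ∀ R : ℕ, ∑ s ∈ Icc 1 (R+1), (1 : ℝ) / (s : ℝ) ^ 2 ≤ 2 - 1 / ((R : ℝ) + 1) := by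
    intro R
    induction R with
    | zero => norm_num
    | succ k ih =>
      rw [Finset.sum_Icc_succ_top (by omega)]
      have : (1 : ℝ) / (((k + 1 + 1 : ℕ) : ℝ)) ^ 2 ≤ 1 / ((k : ℝ) + 1) - 1 / ((k : ℝ) + 2) := by
        push_cast
        rw [div_sub_div _ _ (by positivity) (by positivity), div_le_div_iff₀ (by positivity) (by positivity)]
        nlinarith
      push_cast at this ⊢
      have e : (k : ℝ) + 1 + 1 = k + 2 := by ring
      rw [e] at this ⊢
      linarith
  rcases R with _ | R
  · simp
  · have := key R
    have : 0 ≤ 1 / ((R : ℝ) + 1) := by positivity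
    linarith [key R]

/-- squarefree numbers up to `R` coprime to `d` -/
def sqf (R d : ℕ) : Finset ℕ := (Icc 1 R).filter (fun f => Squarefree f ∧ Nat.Coprime f d)

/-- `σ(d)/d` -/
noncomputable def sg (d : ℕ) : ℝ := ∑ i ∈ d.divisors, (1 : ℝ) / i

lemma harm_le_sqf (R d : ℕ) (hd : 1 ≤ d) :
    ∑ n ∈ Icc 1 R, (1 : ℝ) / n ≤ 2 * sg d * ∑ f ∈ sqf R d, (1 : ℝ) / f := by
  classical
  calc ∑ n ∈ Icc 1 R, (1 : ℝ) / n
      ≤ ∑ x ∈ Icc 1 R ×ˢ d.divisors ×ˢ sqf R d, (1 : ℝ) / (x.1 : ℝ) ^ 2 * (1 / (x.2.1 : ℝ) * (1 / (x.2.2 : ℝ))) := by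
        apply sum_le_sum_cover _ _ _ _ (fun x => x.1 ^ 2 * (x.2.1 * x.2.2))
        · intro b _
          positivity
        · intro n hn
          rw [Finset.mem_Icc] at hn
          obtain ⟨a, b, hab, ha⟩ := Nat.sq_mul_squarefree n
          have ha0 : 0 < a := Nat.pos_of_ne_zero ha.ne_zero
          have hb0 : 0 < b := by
            rcases Nat.eq_zero_or_pos b with h | h
            · subst h; simp at hab; omega
            · exact h
          have hg0 : 0 < Nat.gcd a d := Nat.gcd_pos_of_pos_left _ ha0
          have hga : Nat.gcd a d * (a / Nat.gcd a d) = a := Nat.mul_div_cancel' (Nat.gcd_dvd_left a d)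
          have hq0 : 0 < a / Nat.gcd a d := by
            rcases Nat.eq_zero_or_pos (a / Nat.gcd a d) with h | h
            · rw [h] at hga; omega
            · exact h
          have hqa : a / Nat.gcd a d ∣ a := ⟨_, by rw [mul_comm]; exact hga.symm⟩
          refine ⟨(b, Nat.gcd a d, a / Nat.gcd a d), ?_, ?_, ?_⟩
          · simp only [Finset.mem_product, Finset.mem_Icc, Nat.mem_divisors, sqf, Finset.mem_filter]
            have h1 : b ≤ n := by
              rw [← hab]
              calc b = b * 1 * 1 := by ring
                _ ≤ b * b * a := by gcongr <;> omega
                _ = _ := by ring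
            have h2 : a / Nat.gcd a d ≤ n := by
              apply le_trans (Nat.le_of_dvd ha0 hqa)
              rw [← hab]
              exact Nat.le_mul_of_pos_left a (by positivity)
            refine ⟨⟨hb0, by omega⟩, ⟨Nat.gcd_dvd_right a d, by omega⟩, ⟨hq0, by omega⟩,
              ha.squarefree_of_dvd hqa, ?_⟩
            apply Nat.Coprime.symm
            apply Nat.coprime_of_dvd
            intro k hk hkd hkq
            have h3 : k ∣ Nat.gcd a d := Nat.dvd_gcd (hkq.trans hqa) hkd
            have h4 : k * k ∣ a := by
              rw [← hga]; exact mul_dvd_mul h3 hkq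
            exact hk.one_lt.ne' (Nat.isUnit_iff.1 (ha k h4))
          · simp only
            rw [hga, hab]
          · apply le_of_eq
            simp only
            conv_lhs => rw [← hab]
            conv_lhs => rw [← hga]
            push_cast
            rw [one_div_mul_one_div, one_div_mul_one_div]
    _ = (∑ s ∈ Icc 1 R, (1 : ℝ) / (s : ℝ) ^ 2) * (sg d * ∑ f ∈ sqf R d, (1 : ℝ) / f) := by
        rw [Finset.sum_product, sg, Finset.sum_mul]
        apply Finset.sum_congr rfl
        intro s _
        rw [Finset.sum_product, Finset.sum_mul_sum, Finset.mul_sum]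
        apply Finset.sum_congr rfl
        intro i _
        rw [Finset.mul_sum]
    _ ≤ 2 * (sg d * ∑ f ∈ sqf R d, (1 : ℝ) / f) := by
        gcongr
        · unfold sg; positivity
        · exact sum_inv_sq_le_two R
    _ = _ := by ring

lemma log_le_harm (R : ℕ) : Real.log (R + 1) ≤ ∑ n ∈ Icc 1 R, (1 : ℝ) / n := by
  have := log_add_one_le_harmonic R
  rw [harmonic_eq_sum_Icc] at this
  push_cast at this
  simpa using this

lemma harm_le_log (R : ℕ) : ∑ n ∈ Icc 1 R, (1 : ℝ) / n ≤ 1 + Real.log R := by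
  have := harmonic_le_one_add_log R
  rw [harmonic_eq_sum_Icc] at this
  push_cast at this
  simpa using this

lemma card_ap (T E d : ℕ) (a : ℤ) (hE : 1 ≤ E) (hEd : Nat.Coprime E d) :
    |(((Icc 1 T).filter (fun t : ℕ => (E : ℤ) ∣ a + d * t)).card : ℝ) - (T : ℝ) / E| ≤ 1 := by
  -- find a residue
  obtain ⟨v, hv⟩ : ∃ v : ℕ, ∀ t : ℕ, ((E : ℤ) ∣ a + d * t) ↔ t ≡ v [MOD E] := by
    have : NeZero E := ⟨by omega⟩
    have hu : IsUnit (d : ZMod E) := (ZMod.isUnit_iff_coprime d E).2 hEd.symm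
    obtain ⟨u, hu⟩ := hu
    refine ⟨((- (a : ZMod E)) * (↑u⁻¹ : ZMod E)).val, fun t => ?_⟩
    rw [← ZMod.natCast_eq_natCast_iff, ZMod.natCast_zmod_val, ← ZMod.intCast_zmod_eq_zero_iff_dvd]
    push_cast
    rw [← hu, Units.eq_mul_inv_iff_mul_eq, mul_comm]
    constructor
    · intro h; linear_combination h
    · intro h; linear_combination h
  have e1 : (Icc 1 T).filter (fun t : ℕ => (E : ℤ) ∣ a + d * t) = (Ioc 0 T).filter (fun t => t ≡ v [MOD E]) := by
    ext t
    simp only [Finset.mem_filter, Finset.mem_Icc, Finset.mem_Ioc, hv]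
    rfl
  rw [e1]
  have h2 := Nat.Ioc_filter_modEq_card 0 T (r := E) (by omega) v
  have hEr : (0 : ℚ) < E := by exact_mod_cast hE
  have hle : ⌊(((0:ℕ) : ℚ) - v) / E⌋ ≤ ⌊((T : ℚ) - v) / E⌋ := by
    apply Int.floor_le_floor
    gcongr
    simp
  rw [max_eq_left (by linarith)] at h2
  have a1 := Int.floor_le (((T : ℚ) - v) / E)
  have a2 := Int.lt_floor_add_one (((T : ℚ) - v) / E)
  have a3 := Int.floor_le ((((0:ℕ) : ℚ) - v) / E)
  have a4 := Int.lt_floor_add_one ((((0:ℕ) : ℚ) - v) / E)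
  have h2' : ((#{x ∈ Ioc 0 T | x ≡ v [MOD E]} : ℤ) : ℚ) = (⌊((T : ℚ) - v) / E⌋ : ℚ) - (⌊(((0:ℕ) : ℚ) - v) / E⌋ : ℚ) := by
    rw [h2]; push_cast; rfl
  have e2 : ((T : ℚ) - v) / E - (((0:ℕ) : ℚ) - v) / E = T / E := by
    rw [← sub_div]; congr 1; push_cast; ring
  have fin : |((#{x ∈ Ioc 0 T | x ≡ v [MOD E]} : ℕ) : ℚ) - (T : ℚ) / E| ≤ 1 := by
    rw [abs_le]
    push_cast at h2'
    rw [h2']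
    push_cast at *
    constructor <;> linarith
  have fin' := (Rat.cast_le (K := ℝ)).2 fin
  push_cast at fin'
  exact fin'

/-- the Selberg weights -/
noncomputable def GG (R d : ℕ) : ℝ := ∑ f ∈ sqf R d, (1 : ℝ) / f
noncomputable def lam (R d : ℕ) (e : ℕ) : ℝ :=
  e * ∑ h ∈ (sqf R d).filter (fun h => e ∣ h),
    ((ArithmeticFunction.moebius (h / e) : ℤ) : ℝ) * ((ArithmeticFunction.moebius h : ℤ) : ℝ) / (h * GG R d)

lemma one_mem_sqf (R d : ℕ) (hR : 1 ≤ R) : 1 ∈ sqf R d := by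
  simp [sqf, hR]

lemma GG_ge_one (R d : ℕ) (hR : 1 ≤ R) : 1 ≤ GG R d := by
  unfold GG
  have := Finset.single_le_sum (f := fun f : ℕ => (1 : ℝ) / f) (fun i _ => by positivity) (one_mem_sqf R d hR)
  simpa using this

lemma lam_one (R d : ℕ) (hR : 1 ≤ R) : lam R d 1 = 1 := by
  unfold lam
  have hG := GG_ge_one R d hR
  have : (sqf R d).filter (fun h => 1 ∣ h) = sqf R d := by
    apply Finset.filter_true_of_mem; intro x _; exact one_dvd x
  rw [this]
  have : ∀ h ∈ sqf R d, ((ArithmeticFunction.moebius (h / 1) : ℤ) : ℝ) * ((ArithmeticFunction.moebius h : ℤ) : ℝ) / (h * GG R d) = (1 / (h : ℝ)) / GG R d := by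
    intro h hh
    simp only [sqf, Finset.mem_filter] at hh
    rw [Nat.div_one, ← Int.cast_mul, ← sq, ArithmeticFunction.moebius_sq_eq_one_of_squarefree hh.2.1]
    push_cast
    rw [div_div]
  rw [Finset.sum_congr rfl this, ← Finset.sum_div]
  have : ∑ i ∈ sqf R d, (1 : ℝ) / i = GG R d := rfl
  rw [this, div_self (by linarith)]
  norm_num

lemma abs_moebius_le (n : ℕ) : |((ArithmeticFunction.moebius n : ℤ) : ℝ)| ≤ 1 := by
  exact_mod_cast ArithmeticFunction.abs_moebius_le_one (n := n)

lemma sqf_card (R d : ℕ) : ((sqf R d).card : ℝ) ≤ R := by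
  have : (sqf R d).card ≤ (Icc 1 R).card := Finset.card_filter_le _ _
  simp at this
  exact_mod_cast this

lemma lam_abs (R d e : ℕ) (hR : 1 ≤ R) : |lam R d e| ≤ R := by
  unfold lam
  have hG := GG_ge_one R d hR
  rw [Finset.mul_sum]
  refine (Finset.abs_sum_le_sum_abs _ _).trans ?_
  calc _ ≤ ∑ h ∈ (sqf R d).filter (fun h => e ∣ h), (1 : ℝ) := by
        apply Finset.sum_le_sum
        intro h hh
        simp only [sqf, Finset.mem_filter, Finset.mem_Icc] at hh
        have hpos : (0 : ℝ) < h := by exact_mod_cast hh.1.1.1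
        have heh : (e : ℝ) ≤ h := by exact_mod_cast Nat.le_of_dvd hh.1.1.1 hh.2
        rw [abs_mul, abs_div, abs_mul, abs_mul, abs_of_nonneg (by positivity : (0:ℝ) ≤ e), abs_of_pos hpos,
          abs_of_nonneg (by linarith : 0 ≤ GG R d), ← mul_div_assoc, div_le_one (by positivity)]
        have m1 := abs_moebius_le (h / e)
        have m2 := abs_moebius_le h
        calc _ ≤ (h : ℝ) * (1 * 1) := by gcongr
          _ ≤ h * GG R d := by nlinarith
    _ ≤ R := by
        rw [Finset.sum_const, nsmul_eq_mul, mul_one]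
        refine le_trans ?_ (sqf_card R d)
        exact_mod_cast Finset.card_filter_le _ _

lemma mem_sqf_of_dvd {R d e f : ℕ} (he : e ∈ sqf R d) (hf : f ∣ e) : f ∈ sqf R d := by
  simp only [sqf, Finset.mem_filter, Finset.mem_Icc] at he ⊢
  have h0 : 0 < f := Nat.pos_of_dvd_of_pos hf he.1.1
  exact ⟨⟨h0, (Nat.le_of_dvd he.1.1 hf).trans he.1.2⟩, he.2.1.squarefree_of_dvd hf, he.2.2.coprime_dvd_left hf⟩

lemma moeb_sum {R d f h : ℕ} (hf : f ∈ sqf R d) (hh : h ∈ sqf R d) :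
    ∑ e ∈ (sqf R d).filter (fun e => f ∣ e ∧ e ∣ h), ArithmeticFunction.moebius (h / e) = if f = h then 1 else 0 := by
  have hh0 : 0 < h := by simp only [sqf, Finset.mem_filter, Finset.mem_Icc] at hh; exact hh.1.1
  have hf0 : 0 < f := by simp only [sqf, Finset.mem_filter, Finset.mem_Icc] at hf; exact hf.1.1
  by_cases hfh : f ∣ h
  · obtain ⟨k, rfl⟩ := hfh
    have hk0 : 0 < k := Nat.pos_of_mul_pos_left hh0
    have : ∑ e ∈ (sqf R d).filter (fun e => f ∣ e ∧ e ∣ f * k), ArithmeticFunction.moebius (f * k / e)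
        = ∑ u ∈ k.divisors, ArithmeticFunction.moebius (k / u) := by
      symm
      apply Finset.sum_bij (fun u _ => f * u)
      · intro u hu
        have hu := (Nat.mem_divisors.1 hu).1
        rw [Finset.mem_filter]
        exact ⟨mem_sqf_of_dvd hh (Nat.mul_dvd_mul_left f hu), Dvd.intro _ rfl, Nat.mul_dvd_mul_left f hu⟩
      · intro u _ v _ huv
        exact Nat.eq_of_mul_eq_mul_left hf0 huv
      · intro e he
        rw [Finset.mem_filter] at he
        obtain ⟨u, rfl⟩ := he.2.1
        refine ⟨u, Nat.mem_divisors.2 ⟨Nat.dvd_of_mul_dvd_mul_left hf0 he.2.2, by omega⟩, rfl⟩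
      · intro u hu
        rw [Nat.mul_div_mul_left _ _ hf0]
    rw [this, Nat.sum_div_divisors k (fun n => ArithmeticFunction.moebius n), ← ArithmeticFunction.coe_mul_zeta_apply, ArithmeticFunction.moebius_mul_coe_zeta, ArithmeticFunction.one_apply]
    by_cases h1 : k = 1
    · simp [h1]
    · rw [if_neg h1, if_neg]
      intro h2
      apply h1
      have : f * 1 = f * k := by omega
      exact (Nat.eq_of_mul_eq_mul_left hf0 this).symm
  · rw [if_neg (fun h5 : f = h => hfh (by rw [h5])), Finset.filter_false_of_mem, Finset.sum_empty]
    rintro e _ ⟨h1, h2⟩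
    exact hfh (h1.trans h2)

lemma lam_inv (R d f : ℕ) (hf : f ∈ sqf R d) :
    ∑ e ∈ (sqf R d).filter (fun e => f ∣ e), lam R d e / e = ((ArithmeticFunction.moebius f : ℤ) : ℝ) / (f * GG R d) := by
  calc ∑ e ∈ (sqf R d).filter (fun e => f ∣ e), lam R d e / e
      = ∑ e ∈ sqf R d, ∑ h ∈ sqf R d, if f ∣ e ∧ e ∣ h then ((ArithmeticFunction.moebius (h / e) : ℤ) : ℝ) * (((ArithmeticFunction.moebius h : ℤ) : ℝ) / (h * GG R d)) else 0 := by
        rw [Finset.sum_filter]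
        apply Finset.sum_congr rfl
        intro e he
        have he0 : (e : ℝ) ≠ 0 := by
          simp only [sqf, Finset.mem_filter, Finset.mem_Icc] at he
          have := he.1.1
          positivity
        split_ifs with h1
        · unfold lam
          rw [mul_comm, mul_div_assoc, div_self he0, mul_one, Finset.sum_filter]
          apply Finset.sum_congr rfl
          intro h _
          simp only [h1, true_and]
          split_ifs
          · rw [mul_div_assoc]
          · rfl
        · simp [h1]
    _ = ∑ h ∈ sqf R d, (((∑ e ∈ (sqf R d).filter (fun e => f ∣ e ∧ e ∣ h), ArithmeticFunction.moebius (h / e) : ℤ)) : ℝ) * (((ArithmeticFunction.moebius h : ℤ) : ℝ) / (h * GG R d)) := by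
        rw [Finset.sum_comm]
        apply Finset.sum_congr rfl
        intro h _
        push_cast
        rw [Finset.sum_filter, Finset.sum_mul]
        apply Finset.sum_congr rfl
        intro e _
        split_ifs <;> simp
    _ = _ := by
        rw [Finset.sum_congr rfl (fun h hh => by rw [moeb_sum hf hh])]
        rw [Finset.sum_eq_single f]
        · simp
        · intro b _ hb
          rw [if_neg (Ne.symm hb)]; simp
        · intro h; exact absurd hf h

lemma lcm_inv {R d e1 e2 : ℕ} (h1 : e1 ∈ sqf R d) (h2 : e2 ∈ sqf R d) :
    (1 : ℝ) / (Nat.lcm e1 e2) = ∑ f ∈ sqf R d, if f ∣ e1 ∧ f ∣ e2 then (Nat.totient f : ℝ) / (e1 * e2) else 0 := by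
  have e10 : 0 < e1 := by simp only [sqf, Finset.mem_filter, Finset.mem_Icc] at h1; exact h1.1.1
  have e20 : 0 < e2 := by simp only [sqf, Finset.mem_filter, Finset.mem_Icc] at h2; exact h2.1.1
  rw [← Finset.sum_filter]
  have : (sqf R d).filter (fun f => f ∣ e1 ∧ f ∣ e2) = (Nat.gcd e1 e2).divisors := by
    ext f
    rw [Finset.mem_filter, Nat.mem_divisors, Nat.dvd_gcd_iff]
    constructor
    · rintro ⟨_, h⟩
      exact ⟨h, (Nat.gcd_pos_of_pos_left _ e10).ne'⟩
    · rintro ⟨h, _⟩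
      exact ⟨mem_sqf_of_dvd h1 h.1, h⟩
  rw [this, ← Finset.sum_div, ← Nat.cast_sum, Nat.sum_totient]
  have h3 := Nat.gcd_mul_lcm e1 e2
  have hl : 0 < Nat.lcm e1 e2 := Nat.lcm_pos e10 e20
  have h3' : (Nat.gcd e1 e2 : ℝ) * (Nat.lcm e1 e2) = e1 * e2 := by exact_mod_cast h3
  rw [div_eq_div_iff (by positivity) (by positivity), h3', one_mul]

lemma quad_le (R d : ℕ) (hR : 1 ≤ R) :
    ∑ e1 ∈ sqf R d, ∑ e2 ∈ sqf R d, lam R d e1 * lam R d e2 * (1 / (Nat.lcm e1 e2 : ℝ)) ≤ 1 / GG R d := by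
  have hG := GG_ge_one R d hR
  calc ∑ e1 ∈ sqf R d, ∑ e2 ∈ sqf R d, lam R d e1 * lam R d e2 * (1 / (Nat.lcm e1 e2 : ℝ))
      = ∑ e1 ∈ sqf R d, ∑ e2 ∈ sqf R d, ∑ f ∈ sqf R d, (Nat.totient f : ℝ) * ((if f ∣ e1 then lam R d e1 / e1 else 0) * (if f ∣ e2 then lam R d e2 / e2 else 0)) := by
        apply Finset.sum_congr rfl
        intro e1 h1
        apply Finset.sum_congr rfl
        intro e2 h2
        rw [lcm_inv h1 h2, Finset.mul_sum]
        apply Finset.sum_congr rfl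
        intro f _
        by_cases a1 : f ∣ e1 <;> by_cases a2 : f ∣ e2 <;> simp [a1, a2]
        ring
    _ = ∑ f ∈ sqf R d, (Nat.totient f : ℝ) * (∑ e ∈ (sqf R d).filter (fun e => f ∣ e), lam R d e / e) ^ 2 := by
        rw [Finset.sum_congr rfl (fun e1 _ => Finset.sum_comm), Finset.sum_comm]
        apply Finset.sum_congr rfl
        intro f _
        rw [Finset.sum_filter, sq, Finset.sum_mul_sum, Finset.mul_sum]
        apply Finset.sum_congr rfl
        intro e1 _
        rw [Finset.mul_sum]
    _ ≤ ∑ f ∈ sqf R d, (1 / (f : ℝ)) * (1 / GG R d ^ 2) := by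
        apply Finset.sum_le_sum
        intro f hf
        rw [lam_inv R d f hf]
        have hf0 : (0 : ℝ) < f := by
          simp only [sqf, Finset.mem_filter, Finset.mem_Icc] at hf
          exact_mod_cast hf.1.1
        have ht : (Nat.totient f : ℝ) ≤ f := by exact_mod_cast Nat.totient_le f
        have hm : (((ArithmeticFunction.moebius f : ℤ) : ℝ)) ^ 2 ≤ 1 := by
          rw [← sq_abs]
          have := abs_moebius_le f
          have h0 := abs_nonneg ((ArithmeticFunction.moebius f : ℤ) : ℝ)
          nlinarith
        rw [div_pow, mul_pow]
        calc (Nat.totient f : ℝ) * ((((ArithmeticFunction.moebius f : ℤ) : ℝ)) ^ 2 / ((f:ℝ) ^ 2 * GG R d ^ 2)) ≤ f * (1 / ((f:ℝ) ^ 2 * GG R d ^ 2)) := by gcongr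
          _ = _ := by field_simp
    _ = 1 / GG R d := by
        rw [← Finset.sum_mul]
        have : ∑ i ∈ sqf R d, (1 : ℝ) / i = GG R d := rfl
        rw [this]
        field_simp

theorem sieve_raw (N R d : ℕ) (a : ℤ) (ha : |a| ≤ 1) (hR : 1 ≤ R) (hd : 1 ≤ d) :
    (((Icc 1 N).filter (fun p : ℕ => p.Prime ∧ (d : ℤ) ∣ p - a)).card : ℝ) ≤
      R + ((N : ℝ) + 1) / d / GG R d + (R : ℝ) ^ 4 := by
  classical
  set T := (N + 1) / d with hT
  have hG := GG_ge_one R d hR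
  set w : ℕ → ℝ := fun t => (∑ e ∈ sqf R d, if (e : ℤ) ∣ a + d * t then lam R d e else 0) ^ 2 with hw
  have step1 : (((Icc 1 N).filter (fun p : ℕ => p.Prime ∧ (d : ℤ) ∣ p - a)).card : ℝ) ≤ R + ∑ t ∈ Icc 1 T, w t := by
    have hsub : (Icc 1 N).filter (fun p : ℕ => p.Prime ∧ (d : ℤ) ∣ p - a) ⊆
        Icc 1 R ∪ ((Icc 1 N).filter (fun p : ℕ => (p.Prime ∧ (d : ℤ) ∣ p - a) ∧ R < p)) := by
      intro p hp
      simp only [Finset.mem_union, Finset.mem_filter, Finset.mem_Icc] at hp ⊢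
      by_cases h : p ≤ R
      · left; exact ⟨hp.1.1, h⟩
      · right; exact ⟨hp.1, hp.2, by omega⟩
    have h1 := (Finset.card_le_card hsub).trans (Finset.card_union_le _ _)
    have h2 : (((Icc 1 N).filter (fun p : ℕ => (p.Prime ∧ (d : ℤ) ∣ p - a) ∧ R < p)).card : ℝ) ≤ ∑ t ∈ Icc 1 T, w t := by
      rw [Finset.card_eq_sum_ones]
      push_cast
      apply sum_le_sum_cover _ _ _ _ (fun t : ℕ => (a + d * t).toNat)
      · intro t _; exact sq_nonneg _
      · intro p hp
        simp only [Finset.mem_filter, Finset.mem_Icc] at hp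
        obtain ⟨⟨hp1, hpN⟩, ⟨hpp, t, ht⟩, hRp⟩ := hp
        have hp2 := hpp.two_le
        have ha' := abs_le.1 ha
        have htpos : 0 < t := by
          by_contra hcon
          push Not at hcon
          have : (d : ℤ) * t ≤ 0 := mul_nonpos_of_nonneg_of_nonpos (by positivity) hcon
          omega
        obtain ⟨u, rfl⟩ := Int.eq_ofNat_of_zero_le htpos.le
        have hpa : a + d * (u : ℤ) = p := by linarith
        refine ⟨u, ?_, ?_, ?_⟩
        · rw [Finset.mem_Icc, hT, Nat.le_div_iff_mul_le (by omega)]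
          refine ⟨by omega, ?_⟩
          have : (u : ℤ) * d ≤ N + 1 := by
            have : (p : ℤ) ≤ N := by exact_mod_cast hpN
            linarith
          exact_mod_cast this
        · simp only [hpa, Int.toNat_natCast]
        · rw [hw]
          simp only [hpa]
          rw [Finset.sum_eq_single 1]
          · simp [lam_one R d hR]
          · intro e he he1
            rw [if_neg]
            intro hdv
            have hdv : e ∣ p := by exact_mod_cast hdv
            simp only [sqf, Finset.mem_filter, Finset.mem_Icc] at he
            rcases (Nat.dvd_prime hpp).1 hdv with h | h
            · exact he1 h
            · omega
          · intro h; exact absurd (one_mem_sqf R d hR) h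
    have h1' : (((Icc 1 N).filter (fun p : ℕ => p.Prime ∧ (d : ℤ) ∣ p - a)).card : ℝ) ≤ ((Icc 1 R).card : ℝ) + (((Icc 1 N).filter (fun p : ℕ => (p.Prime ∧ (d : ℤ) ∣ p - a) ∧ R < p)).card : ℝ) := by
      exact_mod_cast h1
    simp only [Nat.card_Icc, Nat.add_sub_cancel] at h1'
    linarith
  have step2 : ∑ t ∈ Icc 1 T, w t = ∑ e1 ∈ sqf R d, ∑ e2 ∈ sqf R d, lam R d e1 * lam R d e2 * (((Icc 1 T).filter (fun t : ℕ => ((Nat.lcm e1 e2 : ℕ) : ℤ) ∣ a + d * t)).card : ℝ) := by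
    have : ∀ t ∈ Icc 1 T, w t = ∑ e1 ∈ sqf R d, ∑ e2 ∈ sqf R d, lam R d e1 * lam R d e2 * (if ((Nat.lcm e1 e2 : ℕ) : ℤ) ∣ a + d * t then 1 else 0) := by
      intro t _
      rw [hw]
      simp only
      rw [sq, Finset.sum_mul_sum]
      apply Finset.sum_congr rfl; intro e1 _
      apply Finset.sum_congr rfl; intro e2 _
      have : ((Nat.lcm e1 e2 : ℕ) : ℤ) ∣ a + d * t ↔ (e1 : ℤ) ∣ a + d * t ∧ (e2 : ℤ) ∣ a + d * t := by
        simp only [Int.natCast_dvd, Nat.lcm_dvd_iff]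
      simp only [this]
      by_cases a1 : (e1 : ℤ) ∣ a + d * t <;> by_cases a2 : (e2 : ℤ) ∣ a + d * t <;> simp [a1, a2]
    rw [Finset.sum_congr rfl this, Finset.sum_comm]
    apply Finset.sum_congr rfl; intro e1 _
    rw [Finset.sum_comm]
    apply Finset.sum_congr rfl; intro e2 _
    rw [← Finset.mul_sum, Finset.sum_boole]
  have step3 : ∑ t ∈ Icc 1 T, w t ≤ T * (1 / GG R d) + (R : ℝ) ^ 4 := by
    rw [step2]
    calc _ ≤ ∑ e1 ∈ sqf R d, ∑ e2 ∈ sqf R d, (T * (lam R d e1 * lam R d e2 * (1 / (Nat.lcm e1 e2 : ℝ))) + (R : ℝ) ^ 2) := by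
          apply Finset.sum_le_sum; intro e1 h1
          apply Finset.sum_le_sum; intro e2 h2
          have l1 := lam_abs R d e1 hR
          have l2 := lam_abs R d e2 hR
          have c1 : 1 ≤ Nat.lcm e1 e2 ∧ Nat.Coprime (Nat.lcm e1 e2) d := by
            simp only [sqf, Finset.mem_filter, Finset.mem_Icc] at h1 h2
            refine ⟨Nat.lcm_pos h1.1.1 h2.1.1, ?_⟩
            exact Nat.Coprime.coprime_dvd_left (Nat.lcm_dvd_mul e1 e2) (Nat.Coprime.mul_left h1.2.2 h2.2.2)
          have c2 := card_ap T (Nat.lcm e1 e2) d a c1.1 c1.2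
          set X := (((Icc 1 T).filter (fun t : ℕ => ((Nat.lcm e1 e2 : ℕ) : ℤ) ∣ a + d * t)).card : ℝ)
          have c3 : lam R d e1 * lam R d e2 * (X - T / (Nat.lcm e1 e2 : ℕ)) ≤ R * R * 1 := by
            refine (le_abs_self _).trans ?_
            rw [abs_mul, abs_mul]
            gcongr
          have : lam R d e1 * lam R d e2 * X = lam R d e1 * lam R d e2 * (X - T / (Nat.lcm e1 e2 : ℕ)) + T * (lam R d e1 * lam R d e2 * (1 / (Nat.lcm e1 e2 : ℝ))) := by ring
          rw [this]
          nlinarith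
      _ = T * (∑ e1 ∈ sqf R d, ∑ e2 ∈ sqf R d, lam R d e1 * lam R d e2 * (1 / (Nat.lcm e1 e2 : ℝ))) + (sqf R d).card * ((sqf R d).card * (R : ℝ) ^ 2) := by
          simp only [Finset.sum_add_distrib, Finset.mul_sum, Finset.sum_const, nsmul_eq_mul]
      _ ≤ _ := by
          have q := quad_le R d hR
          have c := sqf_card R d
          have : (R : ℝ) ^ 4 = R * (R * (R : ℝ) ^ 2) := by ring
          rw [this]
          gcongr
  have hTle : (T : ℝ) ≤ ((N : ℝ) + 1) / d := by
    rw [hT]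
    refine Nat.cast_div_le.trans ?_
    push_cast; rfl
  have : (T : ℝ) * (1 / GG R d) ≤ ((N : ℝ) + 1) / d / GG R d := by
    rw [mul_one_div]
    gcongr
  linarith

theorem sieve_sg (N R d : ℕ) (a : ℤ) (ha : |a| ≤ 1) (hR : 1 ≤ R) (hd : 1 ≤ d) :
    (((Icc 1 N).filter (fun p : ℕ => p.Prime ∧ (d : ℤ) ∣ p - a)).card : ℝ) ≤
      2 * ((N : ℝ) + 1) * (sg d / d) / Real.log (R + 1) + 2 * (R : ℝ) ^ 4 := by
  have h := sieve_raw N R d a ha hR hd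
  have hG := GG_ge_one R d hR
  have h1 := (log_le_harm R).trans (harm_le_sqf R d hd)
  change _ ≤ 2 * sg d * GG R d at h1
  have hRr : (1 : ℝ) ≤ R := by exact_mod_cast hR
  have hlog : 0 < Real.log (R + 1) := Real.log_pos (by linarith)
  have hdr : (0 : ℝ) < d := by exact_mod_cast hd
  have h2 : ((N : ℝ) + 1) / d / GG R d ≤ 2 * ((N : ℝ) + 1) * (sg d / d) / Real.log (R + 1) := by
    rw [div_le_div_iff₀ (by linarith) hlog]
    calc ((N : ℝ) + 1) / d * Real.log (R + 1) ≤ ((N : ℝ) + 1) / d * (2 * sg d * GG R d) := by gcongr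
      _ = _ := by ring
  have h3 : (R : ℝ) ≤ (R : ℝ) ^ 4 := by
    calc (R : ℝ) = R ^ 1 := by ring
      _ ≤ _ := pow_le_pow_right₀ hRr (by norm_num)
  linarith

/-- number of primes of `Q` dividing `n` -/
def gq (Q : Finset ℕ) (n : ℕ) : ℕ := (Q.filter (fun q => q ∣ n)).card

noncomputable def HH (Q : Finset ℕ) (x : ℕ) : ℝ := ∑ m ∈ Icc 1 x, (1 / 2 : ℝ) ^ gq Q m / m

lemma gq_mono (Q : Finset ℕ) {m n : ℕ} (h : m ∣ n) : gq Q m ≤ gq Q n := by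
  apply Finset.card_le_card
  intro q hq
  rw [Finset.mem_filter] at hq ⊢
  exact ⟨hq.1, hq.2.trans h⟩

lemma half_mono (Q : Finset ℕ) {m n : ℕ} (h : m ∣ n) : (1 / 2 : ℝ) ^ gq Q n ≤ (1 / 2 : ℝ) ^ gq Q m :=
  pow_le_pow_of_le_one (by norm_num) (by norm_num) (gq_mono Q h)

lemma HH_mono (Q : Finset ℕ) {x y : ℕ} (h : x ≤ y) : HH Q x ≤ HH Q y := by
  apply Finset.sum_le_sum_of_subset_of_nonneg
  · exact Finset.Icc_subset_Icc_right h
  · intro i _ _; positivity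

lemma HH_nonneg (Q : Finset ℕ) (x : ℕ) : 0 ≤ HH Q x := by unfold HH; positivity

lemma HH_ge (Q : Finset ℕ) (hQ : ∀ q ∈ Q, q.Prime) {x : ℕ} (h : 1 ≤ x) : 1 ≤ HH Q x := by
  have := Finset.single_le_sum (f := fun m : ℕ => (1 / 2 : ℝ) ^ gq Q m / m) (fun i _ => by positivity)
    (Finset.mem_Icc.2 ⟨le_refl 1, h⟩)
  have h2 : gq Q 1 = 0 := by
    unfold gq
    rw [Finset.card_eq_zero, Finset.filter_eq_empty_iff]
    intro q hq hq1
    exact (hQ q hq).one_lt.ne' (Nat.dvd_one.1 hq1)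
  rw [h2] at this
  simpa [HH] using this

lemma ht_one (Q : Finset ℕ) (x : ℕ) :
    ∑ n ∈ Icc 1 x, (1 / 2 : ℝ) ^ gq Q n * Real.log n ≤ (Real.log 4 + 4) * x * HH Q x := by
  classical
  calc ∑ n ∈ Icc 1 x, (1 / 2 : ℝ) ^ gq Q n * Real.log n
      = ∑ y ∈ (Icc 1 x).sigma (fun n => n.divisors), (1 / 2 : ℝ) ^ gq Q y.1 * ArithmeticFunction.vonMangoldt y.2 := by
        rw [Finset.sum_sigma]
        apply Finset.sum_congr rfl
        intro n _
        rw [← ArithmeticFunction.vonMangoldt_sum, Finset.mul_sum]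
    _ ≤ ∑ y ∈ (Icc 1 x).sigma (fun m => Icc 0 ⌊(x : ℝ) / m⌋₊), (1 / 2 : ℝ) ^ gq Q y.1 * ArithmeticFunction.vonMangoldt y.2 := by
        apply sum_le_sum_cover _ _ _ _ (fun y => ⟨y.1 * y.2, y.2⟩)
        · intro b _
          have := ArithmeticFunction.vonMangoldt_nonneg (n := b.2)
          positivity
        · rintro ⟨n, j⟩ hn
          simp only [Finset.mem_sigma, Finset.mem_Icc, Nat.mem_divisors] at hn
          obtain ⟨⟨hn1, hnx⟩, ⟨m, rfl⟩, _⟩ := hn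
          have hm : 0 < m := Nat.pos_of_mul_pos_left hn1
          have hj : 0 < j := Nat.pos_of_mul_pos_right hn1
          refine ⟨⟨m, j⟩, ?_, ?_, ?_⟩
          · simp only [Finset.mem_sigma, Finset.mem_Icc]
            refine ⟨⟨hm, le_trans (Nat.le_mul_of_pos_left m hj) hnx⟩, by omega, ?_⟩
            apply Nat.le_floor
            rw [le_div_iff₀ (by exact_mod_cast hm)]
            exact_mod_cast hnx
          · simp [mul_comm]
          · simp only
            have := ArithmeticFunction.vonMangoldt_nonneg (n := j)
            have := half_mono Q (Dvd.intro_left j rfl : m ∣ j * m)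
            gcongr
    _ = ∑ m ∈ Icc 1 x, (1 / 2 : ℝ) ^ gq Q m * Chebyshev.psi ((x : ℝ) / m) := by
        rw [Finset.sum_sigma]
        apply Finset.sum_congr rfl
        intro m _
        rw [Chebyshev.psi_eq_sum_Icc, Finset.mul_sum]
    _ ≤ ∑ m ∈ Icc 1 x, (Real.log 4 + 4) * x * ((1 / 2 : ℝ) ^ gq Q m / m) := by
        apply Finset.sum_le_sum
        intro m _
        have := Chebyshev.psi_le_const_mul_self (x := (x : ℝ) / m) (by positivity)
        calc _ ≤ (1 / 2 : ℝ) ^ gq Q m * ((Real.log 4 + 4) * ((x : ℝ) / m)) := by gcongr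
          _ = _ := by ring
    _ = _ := by rw [← Finset.mul_sum]; rfl

lemma sum_log_sq : ∃ C : ℝ, 0 ≤ C ∧ ∀ x : ℕ, ∑ i ∈ Icc 1 x, Real.log i / (i : ℝ) ^ 2 ≤ C := by
  have hs : Summable (fun n : ℕ => 2 * (1 / (n : ℝ) ^ (3 / 2 : ℝ))) :=
    (Real.summable_one_div_nat_rpow.2 (by norm_num)).mul_left 2
  refine ⟨∑' n : ℕ, 2 * (1 / (n : ℝ) ^ (3 / 2 : ℝ)), tsum_nonneg (fun n => by positivity), fun x => ?_⟩
  refine le_trans ?_ (hs.sum_le_tsum (Icc 1 x) (fun n _ => by positivity))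
  apply Finset.sum_le_sum
  intro i hi
  have hi0 : (0 : ℝ) < i := by exact_mod_cast (Finset.mem_Icc.1 hi).1
  have h1 : Real.log i ≤ (i : ℝ) ^ (1 / 2 : ℝ) / (1 / 2) := Real.log_le_rpow_div hi0.le (by norm_num)
  rw [div_le_iff₀ (by positivity)]
  have h2 : (i : ℝ) ^ 2 = (i : ℝ) ^ (3 / 2 : ℝ) * (i : ℝ) ^ (1 / 2 : ℝ) := by
    rw [← Real.rpow_add hi0]; norm_num
  rw [h2]
  have : 0 < (i : ℝ) ^ (3 / 2 : ℝ) := by positivity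
  field_simp
  linarith

lemma ht_two : ∃ C : ℝ, 0 < C ∧ ∀ (Q : Finset ℕ) (_ : ∀ q ∈ Q, q.Prime) (x : ℕ) (_ : 1 ≤ x),
    ∑ d ∈ Icc 1 x, (1 / 2 : ℝ) ^ gq Q d * sg d * Real.log d ≤ C * x * HH Q x := by
  classical
  obtain ⟨C, hC, hCs⟩ := sum_log_sq
  have hl4 : 0 < Real.log 4 := Real.log_pos (by norm_num)
  refine ⟨2 * (Real.log 4 + 4) + C, by positivity, fun Q hQ x hx => ?_⟩
  have hH := HH_ge Q hQ hx
  calc ∑ d ∈ Icc 1 x, (1 / 2 : ℝ) ^ gq Q d * sg d * Real.log d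
      = ∑ y ∈ (Icc 1 x).sigma (fun n => n.divisors), (1 / 2 : ℝ) ^ gq Q y.1 * (1 / (y.2 : ℝ)) * Real.log y.1 := by
        rw [Finset.sum_sigma]
        apply Finset.sum_congr rfl
        intro n _
        rw [sg, Finset.mul_sum, Finset.sum_mul]
    _ ≤ ∑ y ∈ (Icc 1 x).sigma (fun i => Icc 1 (x / i)), (1 / 2 : ℝ) ^ gq Q y.2 * (1 / (y.1 : ℝ)) * (Real.log y.1 + Real.log y.2) := by
        apply sum_le_sum_cover _ _ _ _ (fun y => ⟨y.1 * y.2, y.1⟩)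
        · intro b _
          have := Real.log_natCast_nonneg b.1
          have := Real.log_natCast_nonneg b.2
          positivity
        · rintro ⟨n, i⟩ hn
          simp only [Finset.mem_sigma, Finset.mem_Icc, Nat.mem_divisors] at hn
          obtain ⟨⟨hn1, hnx⟩, ⟨m, rfl⟩, _⟩ := hn
          have hm : 0 < m := Nat.pos_of_mul_pos_left hn1
          have hj : 0 < i := Nat.pos_of_mul_pos_right hn1
          refine ⟨⟨i, m⟩, ?_, ?_, ?_⟩
          · simp only [Finset.mem_sigma, Finset.mem_Icc]
            refine ⟨⟨hj, le_trans (Nat.le_mul_of_pos_right i hm) hnx⟩, hm, ?_⟩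
            rw [Nat.le_div_iff_mul_le hj, mul_comm]
            exact hnx
          · simp
          · simp only
            have h1 := half_mono Q (Dvd.intro_left i rfl : m ∣ i * m)
            push_cast
            rw [Real.log_mul (by positivity) (by positivity)]
            have := Real.log_natCast_nonneg i
            have := Real.log_natCast_nonneg m
            gcongr
    _ ≤ ∑ i ∈ Icc 1 x, (2 * 0 + (Real.log 4 + 4) * x * HH Q x * (1 / (i : ℝ) ^ 2) + x * HH Q x * (Real.log i / (i : ℝ) ^ 2)) := by
        rw [Finset.sum_sigma]
        apply Finset.sum_le_sum
        intro i hi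
        have hi0 : (0 : ℝ) < i := by exact_mod_cast (Finset.mem_Icc.1 hi).1
        have hdiv : ((x / i : ℕ) : ℝ) ≤ x / i := Nat.cast_div_le
        have hli := Real.log_natCast_nonneg i
        have h1 := ht_one Q (x / i)
        have h2 : HH Q (x / i) ≤ HH Q x := HH_mono Q (Nat.div_le_self x i)
        have h3 : ∑ m ∈ Icc 1 (x / i), (1 / 2 : ℝ) ^ gq Q m ≤ ((x / i : ℕ) : ℝ) := by
          calc _ ≤ ∑ m ∈ Icc 1 (x / i), (1 : ℝ) := by
                apply Finset.sum_le_sum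
                intro m _
                exact pow_le_one₀ (by norm_num) (by norm_num)
            _ = _ := by simp
        have e : ∑ m ∈ Icc 1 (x / i), (1 / 2 : ℝ) ^ gq Q m * (1 / (i : ℝ)) * (Real.log i + Real.log m)
            = (1 / (i : ℝ)) * Real.log i * (∑ m ∈ Icc 1 (x / i), (1 / 2 : ℝ) ^ gq Q m)
              + (1 / (i : ℝ)) * ∑ m ∈ Icc 1 (x / i), (1 / 2 : ℝ) ^ gq Q m * Real.log m := by
          rw [Finset.mul_sum, Finset.mul_sum, ← Finset.sum_add_distrib]
          apply Finset.sum_congr rfl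
          intro m _
          ring
        rw [e]
        have h4 : (1 / (i : ℝ)) * Real.log i * (∑ m ∈ Icc 1 (x / i), (1 / 2 : ℝ) ^ gq Q m) ≤ x * HH Q x * (Real.log i / (i : ℝ) ^ 2) := by
          calc _ ≤ (1 / (i : ℝ)) * Real.log i * (x / i) := by gcongr; exact h3.trans hdiv
            _ = x * 1 * (Real.log i / (i : ℝ) ^ 2) := by field_simp
            _ ≤ _ := by gcongr
        have h5 : (1 / (i : ℝ)) * ∑ m ∈ Icc 1 (x / i), (1 / 2 : ℝ) ^ gq Q m * Real.log m ≤ (Real.log 4 + 4) * x * HH Q x * (1 / (i : ℝ) ^ 2) := by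
          have hHn := HH_nonneg Q (x / i)
          calc _ ≤ (1 / (i : ℝ)) * ((Real.log 4 + 4) * (x / i) * HH Q x) := by
                gcongr
                refine h1.trans ?_
                gcongr
            _ = _ := by field_simp
        linarith
    _ ≤ (2 * (Real.log 4 + 4) + C) * x * HH Q x := by
        simp only [Finset.sum_add_distrib, ← Finset.mul_sum, mul_zero, zero_add]
        have h1 := sum_inv_sq_le_two x
        have h2 := hCs x
        calc _ ≤ (Real.log 4 + 4) * x * HH Q x * 2 + x * HH Q x * C := by gcongr
          _ = _ := by ring

lemma conv_bound (Q : Finset ℕ) (hQ : ∀ q ∈ Q, q.Prime) (x : ℕ) (hx : 1 ≤ x) :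
    HH Q x * ∑ E ∈ Q.powerset.filter (fun E => ∏ q ∈ E, q ≤ x), ∏ q ∈ E, (1 / (2 * q : ℝ)) ≤ 1 + 2 * Real.log x := by
  classical
  have hlog := harm_le_log (x * x)
  have : Real.log ((x * x : ℕ) : ℝ) = 2 * Real.log x := by
    push_cast
    rw [Real.log_mul (by positivity) (by positivity)]; ring
  rw [this] at hlog
  refine le_trans ?_ hlog
  have e2 : ∑ n ∈ Icc 1 (x * x), (1 : ℝ) / n = ∑ y ∈ (Icc 1 (x * x)).sigma (fun n => (Q.filter (fun q => q ∣ n)).powerset), (1 : ℝ) / y.1 * (1 / 2) ^ gq Q y.1 := by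
    rw [Finset.sum_sigma]
    apply Finset.sum_congr rfl
    intro n _
    simp only [Finset.sum_const, Finset.card_powerset, nsmul_eq_mul]
    change _ = ((2 ^ gq Q n : ℕ) : ℝ) * _
    push_cast
    rw [mul_comm, mul_assoc, ← mul_pow]
    norm_num
  rw [e2, HH, Finset.sum_mul_sum, ← Finset.sum_product']
  have hpos : ∀ E ⊆ Q, 0 < ∏ q ∈ E, q := fun E hE => Finset.prod_pos (fun q hq => (hQ q (hE hq)).pos)
  apply sum_le_sum_cover _ _ _ _ (fun y => (y.1 / ∏ q ∈ y.2, q, y.2))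
  · intro b _
    positivity
  · rintro ⟨m, E⟩ hm
    simp only [Finset.mem_product, Finset.mem_Icc, Finset.mem_filter, Finset.mem_powerset] at hm
    obtain ⟨⟨hm1, hmx⟩, hEQ, hEx⟩ := hm
    have hp := hpos E hEQ
    refine ⟨⟨m * ∏ q ∈ E, q, E⟩, ?_, ?_, ?_⟩
    · simp only [Finset.mem_sigma, Finset.mem_Icc, Finset.mem_powerset]
      refine ⟨⟨Nat.mul_pos hm1 hp, Nat.mul_le_mul hmx hEx⟩, ?_⟩
      intro q hq
      rw [Finset.mem_filter]
      exact ⟨hEQ hq, (Finset.dvd_prod_of_mem _ hq).mul_left m⟩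
    · simp only [Nat.mul_div_cancel _ hp]
    · simp only
      have e3 : ∏ q ∈ E, (1 / (2 * q : ℝ)) = (1 / 2) ^ E.card * (1 / ((∏ q ∈ E, q : ℕ) : ℝ)) := by
        push_cast
        rw [← Finset.prod_const, one_div (∏ q ∈ E, (q : ℝ)), ← Finset.prod_inv_distrib, ← Finset.prod_mul_distrib]
        apply Finset.prod_congr rfl
        intro q _
        rw [one_div, mul_inv, one_div]
      have hg : gq Q (m * ∏ q ∈ E, q) ≤ gq Q m + E.card := by
        unfold gq
        refine le_trans (Finset.card_le_card ?_) (Finset.card_union_le _ _)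
        intro q hq
        rw [Finset.mem_filter] at hq
        rw [Finset.mem_union, Finset.mem_filter]
        have hqp := hQ q hq.1
        rcases (hqp.dvd_mul).1 hq.2 with h | h
        · left; exact ⟨hq.1, h⟩
        · right
          obtain ⟨r, hr, hqr⟩ := (hqp.prime.dvd_finsetProd_iff _).1 h
          rwa [(Nat.prime_dvd_prime_iff_eq hqp (hQ r (hEQ hr))).1 hqr]
      rw [e3]
      calc (1 / 2 : ℝ) ^ gq Q m / m * ((1 / 2) ^ E.card * (1 / ((∏ q ∈ E, q : ℕ) : ℝ)))
          = 1 / ((m * ∏ q ∈ E, q : ℕ) : ℝ) * (1 / 2) ^ (gq Q m + E.card) := by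
            rw [pow_add]; push_cast; field_simp
        _ ≤ _ := by
            gcongr ?_ * ?_
            exact pow_le_pow_of_le_one (by norm_num) (by norm_num) hg

noncomputable def SS (Q : Finset ℕ) : ℝ := ∑ q ∈ Q, (1 : ℝ) / q

lemma trunc_bound (Q : Finset ℕ) (hQ : ∀ q ∈ Q, 50 ≤ q) (x : ℕ) (hx : 1 ≤ x) (l : ℝ) (hl : 0 < l)
    (hQl : ∀ q ∈ Q, Real.log q ≤ l) (hS : 2 * SS Q + 1 ≤ Real.log x / l) :
    Real.exp (0.49 * SS Q) / 2 ≤ ∑ E ∈ Q.powerset.filter (fun E => ∏ q ∈ E, q ≤ x), ∏ q ∈ E, (1 / (2 * q : ℝ)) := by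
  classical
  have hq0 : ∀ q ∈ Q, (0 : ℝ) < q := fun q hq => by have := hQ q hq; positivity
  have hxr : (0 : ℝ) < x := by exact_mod_cast hx
  have hS0 : 0 ≤ SS Q := by unfold SS; positivity
  -- full product
  have full : Real.exp (0.49 * SS Q) ≤ ∑ E ∈ Q.powerset, ∏ q ∈ E, (1 / (2 * q : ℝ)) := by
    rw [← Finset.prod_one_add, SS, Finset.mul_sum, Real.exp_sum]
    apply Finset.prod_le_prod
    · intro q _; positivity
    · intro q hq
      have h50 : (50 : ℝ) ≤ q := by exact_mod_cast hQ q hq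
      have h1 := Real.one_sub_inv_le_log_of_pos (x := 1 + 1 / (2 * q : ℝ)) (by positivity)
      rw [← Real.le_log_iff_exp_le (by positivity)]
      refine le_trans ?_ h1
      have e : 1 - (1 + 1 / (2 * (q : ℝ)))⁻¹ = 1 / (2 * q + 1) := by
        field_simp; ring
      rw [e, mul_one_div, div_le_div_iff₀ (by linarith) (by linarith)]
      nlinarith
  have split := Finset.sum_filter_add_sum_filter_not Q.powerset (fun E => ∏ q ∈ E, q ≤ x) (fun E => ∏ q ∈ E, (1 / (2 * q : ℝ)))
  have tail : ∑ E ∈ Q.powerset.filter (fun E => ¬ ∏ q ∈ E, q ≤ x), ∏ q ∈ E, (1 / (2 * q : ℝ)) ≤ 1 / 2 := by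
    calc _ ≤ ∑ E ∈ Q.powerset.filter (fun E => ¬ ∏ q ∈ E, q ≤ x), Real.exp (- Real.log x / l) * ∏ q ∈ E, (Real.exp (Real.log q / l) / (2 * q : ℝ)) := by
          apply Finset.sum_le_sum
          intro E hE
          rw [Finset.mem_filter, Finset.mem_powerset] at hE
          have hbig : Real.log x ≤ ∑ q ∈ E, Real.log q := by
            rw [← Real.log_prod (fun q hq => (hq0 q (hE.1 hq)).ne')]
            apply Real.log_le_log hxr
            have h9 : (x : ℝ) ≤ ((∏ q ∈ E, q : ℕ) : ℝ) := Nat.cast_le.2 (not_le.1 hE.2).le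
            rwa [Nat.cast_prod] at h9
          have e1 : ∏ q ∈ E, (Real.exp (Real.log q / l) / (2 * q : ℝ)) = Real.exp ((∑ q ∈ E, Real.log q) / l) * ∏ q ∈ E, (1 / (2 * q : ℝ)) := by
            rw [Finset.sum_div, Real.exp_sum, ← Finset.prod_mul_distrib]
            apply Finset.prod_congr rfl
            intro q _
            rw [mul_one_div]
          rw [e1, ← mul_assoc, ← Real.exp_add]
          apply le_mul_of_one_le_left (by positivity)
          rw [Real.one_le_exp_iff, ← add_div]
          apply div_nonneg _ hl.le
          linarith
      _ ≤ ∑ E ∈ Q.powerset, Real.exp (- Real.log x / l) * ∏ q ∈ E, (Real.exp (Real.log q / l) / (2 * q : ℝ)) := by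
          apply Finset.sum_le_sum_of_subset_of_nonneg (Finset.filter_subset _ _)
          intro i _ _; positivity
      _ = Real.exp (- Real.log x / l) * ∏ q ∈ Q, (1 + Real.exp (Real.log q / l) / (2 * q : ℝ)) := by
          rw [← Finset.mul_sum, Finset.prod_one_add]
      _ ≤ Real.exp (- Real.log x / l) * ∏ q ∈ Q, Real.exp (2 * (1 / (q : ℝ))) := by
          gcongr with q hq
          have h1 : Real.exp (Real.log q / l) ≤ 4 := by
            calc _ ≤ Real.exp 1 := by
                  apply Real.exp_le_exp.2
                  rw [div_le_one hl]; exact hQl q hq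
              _ ≤ 4 := by linarith [Real.exp_one_lt_d9]
          have h2 := hq0 q hq
          calc _ ≤ 2 * (1 / (q : ℝ)) + 1 := by
                have : Real.exp (Real.log q / l) / (2 * q : ℝ) ≤ 4 / (2 * q) := by gcongr
                have e : 4 / (2 * (q : ℝ)) = 2 * (1 / q) := by field_simp; norm_num
                linarith
            _ ≤ _ := Real.add_one_le_exp _
      _ = Real.exp (- Real.log x / l + 2 * SS Q) := by
          rw [← Real.exp_sum, ← Finset.mul_sum, Real.exp_add]; rfl
      _ ≤ Real.exp (-1) := by
          apply Real.exp_le_exp.2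
          rw [neg_div]; linarith
      _ ≤ 1 / 2 := by
          rw [Real.exp_neg, one_div]
          apply inv_anti₀ (by norm_num)
          linarith [Real.exp_one_gt_d9]
  have h1 : (1 : ℝ) ≤ Real.exp (0.49 * SS Q) := by
    rw [Real.one_le_exp_iff]; positivity
  linarith

lemma HH_le (Q : Finset ℕ) (hQp : ∀ q ∈ Q, q.Prime) (hQ : ∀ q ∈ Q, 50 ≤ q) (x : ℕ) (hx : 1 ≤ x) (l : ℝ) (hl : 0 < l)
    (hQl : ∀ q ∈ Q, Real.log q ≤ l) (hS : 2 * SS Q + 1 ≤ Real.log x / l) :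
    HH Q x ≤ 2 * (1 + 2 * Real.log x) * Real.exp (- (0.49 * SS Q)) := by
  have h1 := conv_bound Q hQp x hx
  have h2 := trunc_bound Q hQ x hx l hl hQl hS
  have h0 := HH_nonneg Q x
  have h3 : HH Q x * (Real.exp (0.49 * SS Q) / 2) ≤ 1 + 2 * Real.log x := le_trans (by gcongr) h1
  rw [Real.exp_neg, ← div_eq_mul_inv, le_div_iff₀ (Real.exp_pos _)]
  linarith

lemma esymm_le (k : ℕ) (Q : Finset ℕ) (x : ℕ → ℝ) (hx : ∀ q ∈ Q, 0 ≤ x q) :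
    ∑ E ∈ Q.powersetCard k, ∏ q ∈ E, x q ≤ (∑ q ∈ Q, x q) ^ k / (k.factorial : ℝ) := by
  classical
  induction Q using Finset.induction_on generalizing k with
  | empty =>
    rcases k with _ | k
    · simp
    · rw [Finset.powersetCard_eq_empty.2 (by simp)]
      simp
  | insert a s ha ih =>
    have hs : ∀ q ∈ s, 0 ≤ x q := fun q hq => hx q (Finset.mem_insert_of_mem hq)
    have hxa : 0 ≤ x a := hx a (Finset.mem_insert_self a s)
    rcases k with _ | k
    · simp
    · rw [Finset.powersetCard_succ_insert ha, Finset.sum_union, Finset.sum_image]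
      · have h1 := ih (k + 1) hs
        have h2 := ih k hs
        have hS : 0 ≤ ∑ q ∈ s, x q := Finset.sum_nonneg hs
        have e1 : ∑ E ∈ s.powersetCard k, ∏ q ∈ insert a E, x q = x a * ∑ E ∈ s.powersetCard k, ∏ q ∈ E, x q := by
          rw [Finset.mul_sum]
          apply Finset.sum_congr rfl
          intro E hE
          rw [Finset.prod_insert]
          intro h
          exact ha ((Finset.mem_powersetCard.1 hE).1 h)
        rw [e1, Finset.sum_insert ha]
        set S := ∑ q ∈ s, x q
        have h3 : S ^ (k + 1) + (k + 1) * x a * S ^ k ≤ (x a + S) ^ (k + 1) := by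
          have : ∀ k : ℕ, S ^ (k + 1) + (k + 1) * x a * S ^ k ≤ (x a + S) ^ (k + 1) := by
            intro k
            induction k with
            | zero => simp; linarith
            | succ j ihj =>
              have h5 : 0 ≤ (j + 1 : ℝ) * x a * S ^ j * x a := by positivity
              calc S ^ (j + 1 + 1) + ((j + 1 : ℕ) + 1) * x a * S ^ (j + 1)
                  ≤ (S ^ (j + 1) + (j + 1) * x a * S ^ j) * (x a + S) := by
                    push_cast
                    have : (S ^ (j + 1) + (j + 1) * x a * S ^ j) * (x a + S) = S ^ (j + 1 + 1) + ((j + 1 : ℝ) + 1) * x a * S ^ (j + 1) + (j + 1 : ℝ) * x a * S ^ j * x a := by ring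
                    rw [this]; linarith
                _ ≤ (x a + S) ^ (j + 1) * (x a + S) := by gcongr
                _ = _ := by ring
          exact this k
        calc _ ≤ S ^ (k + 1) / ((k + 1).factorial : ℝ) + x a * (S ^ k / (k.factorial : ℝ)) := by gcongr
          _ = (S ^ (k + 1) + (k + 1) * x a * S ^ k) / ((k + 1).factorial : ℝ) := by
            rw [Nat.factorial_succ]; push_cast; field_simp
          _ ≤ _ := by gcongr
      · intro E hE F hF hEF
        have hE' : a ∉ E := fun h => ha ((Finset.mem_powersetCard.1 hE).1 h)
        have hF' : a ∉ F := fun h => ha ((Finset.mem_powersetCard.1 hF).1 h)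
        rw [← Finset.erase_insert hE', ← Finset.erase_insert hF', hEF]
      · rw [Finset.disjoint_left]
        intro E hE hE2
        obtain ⟨F, _, rfl⟩ := Finset.mem_image.1 hE2
        exact ha ((Finset.mem_powersetCard.1 hE).1 (Finset.mem_insert_self a F))

lemma sg_prime_mul (q d : ℕ) (hq : q.Prime) (hd : 1 ≤ d) : sg (q * d) ≤ (1 + 1 / q) * sg d := by
  classical
  have hsub : (q * d).divisors ⊆ d.divisors ∪ d.divisors.image (fun j => q * j) := by
    intro i hi
    rw [Nat.mem_divisors] at hi
    rw [Finset.mem_union, Finset.mem_image]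
    by_cases h : q ∣ i
    · right
      obtain ⟨j, rfl⟩ := h
      exact ⟨j, Nat.mem_divisors.2 ⟨Nat.dvd_of_mul_dvd_mul_left hq.pos hi.1, by omega⟩, rfl⟩
    · left
      exact Nat.mem_divisors.2 ⟨(Nat.Coprime.dvd_of_dvd_mul_left (((Nat.Prime.coprime_iff_not_dvd hq).2 h).symm) hi.1), by omega⟩
  unfold sg
  calc _ ≤ ∑ i ∈ d.divisors ∪ d.divisors.image (fun j => q * j), (1 : ℝ) / i :=
        Finset.sum_le_sum_of_subset_of_nonneg hsub (fun i _ _ => by positivity)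
    _ ≤ ∑ i ∈ d.divisors, (1 : ℝ) / i + ∑ i ∈ d.divisors.image (fun j => q * j), (1 : ℝ) / i := by
        rw [← Finset.sum_union_inter]
        have : 0 ≤ ∑ i ∈ d.divisors ∩ d.divisors.image (fun j => q * j), (1 : ℝ) / i := Finset.sum_nonneg (fun i _ => by positivity)
        linarith
    _ = _ := by
        rw [Finset.sum_image (fun a _ b _ h => Nat.eq_of_mul_eq_mul_left hq.pos h), add_mul, one_mul, Finset.mul_sum]
        congr 1
        apply Finset.sum_congr rfl
        intro j _
        push_cast
        rw [one_div_mul_one_div]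

lemma sg_nonneg (d : ℕ) : 0 ≤ sg d := by unfold sg; positivity

lemma sg_one : sg 1 = 1 := by simp [sg]

lemma sg_prod (E : Finset ℕ) (hE : ∀ q ∈ E, q.Prime) (h20 : ∀ q ∈ E, 20 ≤ q) :
    sg (∏ q ∈ E, q) / ((∏ q ∈ E, q : ℕ) : ℝ) ≤ ∏ q ∈ E, (1.05 * (1 / (q : ℝ))) := by
  classical
  induction E using Finset.induction_on with
  | empty => simp [sg_one]
  | insert a s ha ih =>
    have h1 := ih (fun q hq => hE q (Finset.mem_insert_of_mem hq)) (fun q hq => h20 q (Finset.mem_insert_of_mem hq))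
    have hap := hE a (Finset.mem_insert_self a s)
    have ha20 : (20 : ℝ) ≤ a := by exact_mod_cast h20 a (Finset.mem_insert_self a s)
    have hpos : 1 ≤ ∏ q ∈ s, q := Finset.prod_pos (fun q hq => (hE q (Finset.mem_insert_of_mem hq)).pos)
    rw [Finset.prod_insert ha, Finset.prod_insert ha]
    have h2 := sg_prime_mul a _ hap hpos
    have h3 : (1 : ℝ) + 1 / a ≤ 1.05 := by
      have : (1 : ℝ) / a ≤ 1 / 20 := by gcongr
      linarith
    have h4 := sg_nonneg (∏ q ∈ s, q)
    calc _ ≤ ((1 + 1 / (a : ℝ)) * sg (∏ q ∈ s, q)) / ((a * ∏ q ∈ s, q : ℕ) : ℝ) := by gcongr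
      _ ≤ (1.05 * sg (∏ q ∈ s, q)) / ((a * ∏ q ∈ s, q : ℕ) : ℝ) := by gcongr
      _ = 1.05 * (1 / (a : ℝ)) * (sg (∏ q ∈ s, q) / ((∏ q ∈ s, q : ℕ) : ℝ)) := by
          rw [Nat.cast_mul]; field_simp
      _ ≤ _ := by gcongr

lemma prod_dvd_iff_primes (E : Finset ℕ) (hE : ∀ q ∈ E, q.Prime) (n : ℕ) :
    ∏ q ∈ E, q ∣ n ↔ ∀ q ∈ E, q ∣ n := by
  constructor
  · intro h q hq
    exact (Finset.dvd_prod_of_mem _ hq).trans h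
  · intro h
    exact Finset.prod_primes_dvd n (fun q hq => (hE q hq).prime) h

lemma moment (k : ℕ) (Q : Finset ℕ) (hQ : ∀ q ∈ Q, q.Prime) (h20 : ∀ q ∈ Q, 20 ≤ q)
    (P : Finset ℕ) (n : ℕ → ℕ) (B : ℝ) (hB : 0 ≤ B) (hS0 : 0 < SS Q) (hS : 10 * (k : ℝ) ≤ SS Q)
    (hsv : ∀ E ∈ Q.powersetCard k, ((P.filter (fun p => ∏ q ∈ E, q ∣ n p)).card : ℝ) ≤ B * (sg (∏ q ∈ E, q) / ((∏ q ∈ E, q : ℕ) : ℝ))) :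
    ((P.filter (fun p => 1.2 * SS Q < gq Q (n p))).card : ℝ) ≤ B * (1.05 / 1.1) ^ k := by
  classical
  have up : ∑ p ∈ P, ((gq Q (n p)).choose k : ℝ) ≤ B * ((1.05 * SS Q) ^ k / (k.factorial : ℝ)) := by
    calc ∑ p ∈ P, ((gq Q (n p)).choose k : ℝ) = ∑ p ∈ P, ∑ E ∈ Q.powersetCard k, (if ∏ q ∈ E, q ∣ n p then (1 : ℝ) else 0) := by
          apply Finset.sum_congr rfl
          intro p _
          rw [Finset.sum_boole, gq, ← Finset.card_powersetCard]
          congr 2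
          ext E
          simp only [Finset.mem_powersetCard, Finset.mem_filter]
          constructor
          · rintro ⟨h1, h2⟩
            have h3 : E ⊆ Q := h1.trans (Finset.filter_subset _ _)
            refine ⟨⟨h3, h2⟩, ?_⟩
            rw [prod_dvd_iff_primes E (fun q hq => hQ q (h3 hq))]
            intro q hq
            exact (Finset.mem_filter.1 (h1 hq)).2
          · rintro ⟨⟨h3, h2⟩, h4⟩
            refine ⟨?_, h2⟩
            rw [prod_dvd_iff_primes E (fun q hq => hQ q (h3 hq))] at h4
            intro q hq
            exact Finset.mem_filter.2 ⟨h3 hq, h4 q hq⟩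
      _ = ∑ E ∈ Q.powersetCard k, ((P.filter (fun p => ∏ q ∈ E, q ∣ n p)).card : ℝ) := by
          rw [Finset.sum_comm]
          apply Finset.sum_congr rfl
          intro E _
          rw [Finset.sum_boole]
      _ ≤ ∑ E ∈ Q.powersetCard k, B * ∏ q ∈ E, (1.05 * (1 / (q : ℝ))) := by
          apply Finset.sum_le_sum
          intro E hE
          have h3 := (Finset.mem_powersetCard.1 hE).1
          refine (hsv E hE).trans ?_
          gcongr
          exact sg_prod E (fun q hq => hQ q (h3 hq)) (fun q hq => h20 q (h3 hq))
      _ ≤ _ := by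
          rw [← Finset.mul_sum]
          gcongr
          refine (esymm_le k Q (fun q => 1.05 * (1 / (q : ℝ))) (fun q _ => by positivity)).trans ?_
          rw [← Finset.mul_sum]; rfl
  have lo : ((P.filter (fun p => 1.2 * SS Q < gq Q (n p))).card : ℝ) * ((1.1 * SS Q) ^ k / (k.factorial : ℝ)) ≤ ∑ p ∈ P, ((gq Q (n p)).choose k : ℝ) := by
    rw [← nsmul_eq_mul, ← Finset.sum_const]
    refine le_trans ?_ (Finset.sum_le_sum_of_subset_of_nonneg (Finset.filter_subset (fun p => 1.2 * SS Q < gq Q (n p)) P) (fun _ _ _ => by positivity))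
    apply Finset.sum_le_sum
    intro p hp
    have hp := (Finset.mem_filter.1 hp).2
    set g := gq Q (n p)
    have hk : (k : ℝ) ≤ g := by linarith
    have hk' : k ≤ g := by exact_mod_cast hk
    have h1 := Nat.pow_sub_le_descFactorial g k
    rw [Nat.descFactorial_eq_factorial_mul_choose] at h1
    have h2 : ((g + 1 - k : ℕ) : ℝ) ^ k ≤ (k.factorial : ℝ) * (g.choose k : ℝ) := by exact_mod_cast h1
    rw [div_le_iff₀ (by positivity), mul_comm (g.choose k : ℝ)]
    refine le_trans ?_ h2
    rw [Nat.cast_sub (by omega)]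
    push_cast
    gcongr
    linarith
  have hlast := lo.trans up
  have hk0 : (0 : ℝ) < k.factorial := by positivity
  have hp : 0 < (1.1 * SS Q) ^ k := by positivity
  rw [← mul_div_assoc, ← mul_div_assoc, div_le_div_iff_of_pos_right hk0] at hlast
  rw [div_pow, ← mul_div_assoc, le_div_iff₀ (by positivity)]
  rw [mul_pow, mul_pow] at hlast
  have hsk : 0 < SS Q ^ k := by positivity
  nlinarith [hlast, hsk]

lemma fib_rank (p : ℕ) (hp : p.Prime) (h5 : p ≠ 5) : p ∣ Nat.fib (p - 1) ∨ p ∣ Nat.fib (p + 1) := by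
  have : Fact p.Prime := ⟨hp⟩
  let K := AlgebraicClosure (ZMod p)
  have : CharP K p := charP_of_injective_algebraMap (algebraMap (ZMod p) K).injective p
  obtain ⟨α, hα⟩ : ∃ α : K, α ^ 2 = α + 1 := by
    obtain ⟨x, hx⟩ := IsAlgClosed.exists_root (Polynomial.X ^ 2 - Polynomial.X - 1 : Polynomial K) (by
      have : (Polynomial.X ^ 2 - Polynomial.X - 1 : Polynomial K).degree = 2 := by compute_degree!
      rw [this]; norm_num)
    refine ⟨x, ?_⟩
    simp [Polynomial.IsRoot] at hx
    linear_combination hx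
  have binet : ∀ n : ℕ, (Nat.fib n : K) * (2 * α - 1) = α ^ n - (1 - α) ^ n ∧
      (Nat.fib (n + 1) : K) * (2 * α - 1) = α ^ (n + 1) - (1 - α) ^ (n + 1) := by
    intro n
    induction n with
    | zero => simp; ring
    | succ k ih =>
      refine ⟨ih.2, ?_⟩
      rw [Nat.fib_add_two]
      push_cast
      rw [add_mul, ih.1, ih.2]
      have e1 : α ^ (k + 1 + 1) = α ^ k * (α + 1) := by rw [← hα]; ring
      have e2 : (1 - α) ^ (k + 1 + 1) = (1 - α) ^ k * (2 - α) := by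
        have : (1 - α) ^ 2 = 2 - α := by linear_combination hα
        rw [← this]; ring
      rw [e1, e2]; ring
  have hne : (2 * α - 1) ≠ 0 := by
    intro h
    have h2 : (5 : K) = 0 := by linear_combination (2 * α - 1) * h - 4 * hα
    have h3 : ((5 : ℕ) : K) = 0 := by exact_mod_cast h2
    rw [CharP.cast_eq_zero_iff K p] at h3
    exact h5 ((Nat.prime_dvd_prime_iff_eq hp (by norm_num)).1 h3)
  have hα0 : α ≠ 0 := by
    intro h; rw [h] at hα; simp at hα
  have hβ0 : 1 - α ≠ 0 := by
    intro h
    have : (1 : K) = 0 := by linear_combination -(α) * h - hα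
    exact one_ne_zero this
  have hroot : (α ^ p) ^ 2 = α ^ p + 1 := by
    rw [← pow_mul, mul_comm, pow_mul, hα, add_pow_char, one_pow]
  have hβp : (1 - α) ^ p = 1 - α ^ p := by rw [sub_pow_char, one_pow]
  have hcases : (α ^ p - α) * (α ^ p - (1 - α)) = 0 := by linear_combination hroot - hα
  have fin : ∀ n : ℕ, α ^ n = (1 - α) ^ n → p ∣ Nat.fib n := by
    intro n hn
    have h := (binet n).1
    rw [hn, sub_self] at h
    rw [← CharP.cast_eq_zero_iff K p]
    exact (mul_eq_zero.1 h).resolve_right hne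
  rcases mul_eq_zero.1 hcases with h | h
  · left
    apply fin
    have h1 : α ^ p = α := by linear_combination h
    have e : p = (p - 1) + 1 := by have := hp.pos; omega
    have a1 : α ^ (p - 1) = 1 := by
      apply mul_right_cancel₀ hα0
      rw [← pow_succ, ← e, h1, one_mul]
    have a2 : (1 - α) ^ (p - 1) = 1 := by
      apply mul_right_cancel₀ hβ0
      rw [← pow_succ, ← e, hβp, h1, one_mul]
    rw [a1, a2]
  · right
    apply fin
    have h1 : α ^ p = 1 - α := by linear_combination h
    rw [pow_succ, pow_succ, hβp, h1]; ring

lemma z_spec (p : ℕ) (hp : p.Prime) (h5 : p ≠ 5) :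
    0 < orderOfAppearance p ∧ p ∣ Nat.fib (orderOfAppearance p) ∧
      (orderOfAppearance p ∣ p - 1 ∨ orderOfAppearance p ∣ p + 1) := by
  have hr := fib_rank p hp h5
  have h2 := hp.two_le
  have hne : {ℓ : ℕ | 0 < ℓ ∧ p ∣ Nat.fib ℓ}.Nonempty := by
    rcases hr with h | h
    · exact ⟨p - 1, by omega, h⟩
    · exact ⟨p + 1, by omega, h⟩
  have hm := Nat.sInf_mem hne
  have hdiv : ∀ n, 0 < n → p ∣ Nat.fib n → orderOfAppearance p ∣ n := by
    intro n hn hpn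
    have hg : p ∣ Nat.fib (Nat.gcd (orderOfAppearance p) n) := by
      rw [Nat.fib_gcd]; exact Nat.dvd_gcd hm.2 hpn
    have hle : orderOfAppearance p ≤ Nat.gcd (orderOfAppearance p) n :=
      Nat.sInf_le ⟨Nat.gcd_pos_of_pos_right _ hn, hg⟩
    have heq : Nat.gcd (orderOfAppearance p) n = orderOfAppearance p :=
      le_antisymm (Nat.le_of_dvd hm.1 (Nat.gcd_dvd_left _ _)) hle
    rw [← heq]; exact Nat.gcd_dvd_right _ _
  refine ⟨hm.1, hm.2, ?_⟩
  rcases hr with h | h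
  · left; exact hdiv _ (by omega) h
  · right; exact hdiv _ (by omega) h

lemma fib_le_two_pow (n : ℕ) : Nat.fib n ≤ 2 ^ n ∧ Nat.fib (n + 1) ≤ 2 ^ n := by
  induction n with
  | zero => simp
  | succ k ih =>
    refine ⟨ih.2.trans (Nat.pow_le_pow_right (by norm_num) (by omega)), ?_⟩
    rw [Nat.fib_add_two, pow_succ]; omega

lemma card_pf_fib (l : ℕ) (hl : 0 < l) : (Nat.fib l).primeFactors.card ≤ l := by
  have h0 : 0 < Nat.fib l := Nat.fib_pos.2 hl
  have h1 : 2 ^ (Nat.fib l).primeFactors.card ≤ ∏ q ∈ (Nat.fib l).primeFactors, q := by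
    rw [← Finset.prod_const]
    exact Finset.prod_le_prod' (fun q hq => (Nat.prime_of_mem_primeFactors hq).two_le)
  have h2 := Nat.le_of_dvd h0 (Nat.prod_primeFactors_dvd (Nat.fib l))
  have h3 := (h1.trans h2).trans (fib_le_two_pow l).1
  exact (Nat.pow_le_pow_iff_right (by norm_num)).1 h3

lemma card_small_z (N T : ℕ) :
    ((Icc 1 N).filter (fun p : ℕ => p.Prime ∧ p ≠ 5 ∧ orderOfAppearance p ≤ T)).card ≤ T * T := by
  classical
  have hsub : (Icc 1 N).filter (fun p : ℕ => p.Prime ∧ p ≠ 5 ∧ orderOfAppearance p ≤ T) ⊆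
      (Icc 1 T).biUnion (fun l => (Nat.fib l).primeFactors) := by
    intro p hp
    rw [Finset.mem_filter] at hp
    obtain ⟨_, hpp, h5, hz⟩ := hp
    have hs := z_spec p hpp h5
    rw [Finset.mem_biUnion]
    exact ⟨_, Finset.mem_Icc.2 ⟨hs.1, hz⟩, Nat.mem_primeFactors.2 ⟨hpp, hs.2.1, (Nat.fib_pos.2 hs.1).ne'⟩⟩
  refine (Finset.card_le_card hsub).trans ?_
  have := Finset.card_biUnion_le_card_mul (Icc 1 T) (fun l => (Nat.fib l).primeFactors) T (by
    intro l hl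
    rw [Finset.mem_Icc] at hl
    exact (card_pf_fib l hl.1).trans hl.2)
  simpa using this

lemma sg_ge_one (d : ℕ) (hd : 1 ≤ d) : 1 ≤ sg d := by
  unfold sg
  have := Finset.single_le_sum (f := fun f : ℕ => (1 : ℝ) / f) (fun i _ => by positivity)
    (Nat.one_mem_divisors.2 (by omega : d ≠ 0))
  simpa using this

lemma sieve_final (N : ℕ) (hN : 2 ≤ N) (d : ℕ) (hd : 1 ≤ d) (hdN : (d : ℝ) ≤ Real.exp (0.6 * Real.log N))
    (a : ℤ) (ha : |a| ≤ 1) :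
    (((Icc 1 N).filter (fun p : ℕ => p.Prime ∧ (d : ℤ) ∣ p - a)).card : ℝ) ≤
      100 * ((N : ℝ) / Real.log N) * (sg d / d) := by
  have hN1 : (1 : ℝ) < N := by exact_mod_cast hN
  set L := Real.log N with hL
  have hLpos : 0 < L := Real.log_pos hN1
  have hNexp : (N : ℝ) = Real.exp L := (Real.exp_log (by linarith)).symm
  set R := ⌊Real.exp (L / 16)⌋₊ with hR
  have hR1 : 1 ≤ R := by
    apply Nat.le_floor
    simpa using (by positivity : 0 ≤ L / 16)
  have hRle : (R : ℝ) ≤ Real.exp (L / 16) := Nat.floor_le (Real.exp_pos _).le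
  have hRlt : Real.exp (L / 16) < R + 1 := Nat.lt_floor_add_one _
  have hlogR : L / 16 ≤ Real.log (R + 1) := by
    rw [Real.le_log_iff_exp_le (by positivity)]; exact hRlt.le
  have hR4 : (R : ℝ) ^ 4 ≤ Real.exp (L / 4) := by
    calc (R : ℝ) ^ 4 ≤ (Real.exp (L / 16)) ^ 4 := by gcongr
      _ = _ := by rw [← Real.exp_nat_mul]; congr 1; push_cast; ring
  have hdr : (0 : ℝ) < d := by exact_mod_cast hd
  have hsg := sg_ge_one d hd
  have h := sieve_sg N R d a ha hR1 hd
  have h1 : 2 * ((N : ℝ) + 1) * (sg d / d) / Real.log (R + 1) ≤ 64 * ((N : ℝ) / L) * (sg d / d) := by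
    calc _ ≤ 2 * ((N : ℝ) + N) * (sg d / d) / (L / 16) := by gcongr
      _ = _ := by field_simp; norm_num
  have h2 : 2 * (R : ℝ) ^ 4 ≤ 36 * ((N : ℝ) / L) * (sg d / d) := by
    have e1 : Real.exp (L / 4) * (L / 18) ≤ Real.exp (0.4 * L) := by
      have : 0.4 * L = L / 4 + 0.15 * L := by ring
      rw [this, Real.exp_add]
      gcongr
      have := Real.add_one_le_exp (0.15 * L)
      linarith
    have e2 : Real.exp (0.4 * L) * d ≤ N := by
      calc _ ≤ Real.exp (0.4 * L) * Real.exp (0.6 * L) := by gcongr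
        _ = N := by rw [← Real.exp_add, hNexp]; congr 1; ring
    calc 2 * (R : ℝ) ^ 4 ≤ 2 * Real.exp (L / 4) := by gcongr
      _ ≤ 36 * ((N : ℝ) / L) * (1 / d) := by
          rw [mul_one_div, le_div_iff₀ hdr, ← mul_div_assoc, le_div_iff₀ hLpos]
          have := mul_le_mul_of_nonneg_right e1 hdr.le
          nlinarith
      _ ≤ _ := by gcongr
  linarith

lemma mertens_lower (y : ℕ) : Real.log (y + 1) ≤
    2 * Real.exp (∑ q ∈ (Icc 1 y).filter Nat.Prime, (1 : ℝ) / q) := by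
  classical
  have h1 := (log_le_harm y).trans (harm_le_sqf y 1 le_rfl)
  rw [sg_one, mul_one] at h1
  refine h1.trans ?_
  gcongr
  calc ∑ f ∈ sqf y 1, (1 : ℝ) / f ≤ ∑ E ∈ ((Icc 1 y).filter Nat.Prime).powerset, ∏ q ∈ E, (1 : ℝ) / q := by
        apply sum_le_sum_cover _ _ _ _ (fun E => ∏ q ∈ E, q)
        · intro E _; positivity
        · intro f hf
          simp only [sqf, Finset.mem_filter, Finset.mem_Icc] at hf
          have hprod := Nat.prod_primeFactors_of_squarefree hf.2.1
          refine ⟨f.primeFactors, ?_, hprod, ?_⟩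
          · rw [Finset.mem_powerset]
            intro q hq
            have hq' := Nat.mem_primeFactors.1 hq
            rw [Finset.mem_filter, Finset.mem_Icc]
            exact ⟨⟨hq'.1.pos, (Nat.le_of_dvd hf.1.1 hq'.2.1).trans hf.1.2⟩, hq'.1⟩
          · apply le_of_eq
            conv_lhs => rw [← hprod]
            push_cast
            simp only [one_div]
            rw [Finset.prod_inv_distrib]
    _ = ∏ q ∈ (Icc 1 y).filter Nat.Prime, (1 + (1 : ℝ) / q) := by rw [Finset.prod_one_add]
    _ ≤ _ := by
        rw [Real.exp_sum]
        apply Finset.prod_le_prod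
        · intro q _; positivity
        · intro q _
          have := Real.add_one_le_exp ((1 : ℝ) / q)
          linarith

/-- primes in `(w, y]` -/
def QQ (w y : ℕ) : Finset ℕ := (Ioc w y).filter Nat.Prime

lemma SS_lower (w y : ℕ) (hw : 1 ≤ w) (hwy : w ≤ y) (hy : 1 ≤ y) :
    Real.log (Real.log (y + 1)) - 2 - Real.log w ≤ SS (QQ w y) := by
  classical
  have h1 := mertens_lower y
  have hy' : (1 : ℝ) ≤ y := by exact_mod_cast hy
  have hpos : 0 < Real.log (y + 1) := Real.log_pos (by linarith)
  have h2 := Real.log_le_log hpos h1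
  rw [Real.log_mul (by norm_num) (Real.exp_pos _).ne', Real.log_exp] at h2
  have h3 : ∑ q ∈ (Icc 1 y).filter Nat.Prime, (1 : ℝ) / q ≤ ∑ q ∈ Icc 1 w, (1 : ℝ) / q + SS (QQ w y) := by
    have hsub : (Icc 1 y).filter Nat.Prime ⊆ Icc 1 w ∪ QQ w y := by
      intro q hq
      simp only [Finset.mem_filter, Finset.mem_Icc, Finset.mem_union, QQ, Finset.mem_Ioc] at hq ⊢
      by_cases h : q ≤ w
      · left; exact ⟨hq.1.1, h⟩
      · right; exact ⟨⟨by omega, hq.1.2⟩, hq.2⟩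
    refine (Finset.sum_le_sum_of_subset_of_nonneg hsub (fun _ _ _ => by positivity)).trans ?_
    rw [Finset.sum_union]
    · rfl
    · rw [Finset.disjoint_left]
      intro q hq hq2
      simp only [QQ, Finset.mem_filter, Finset.mem_Icc, Finset.mem_Ioc] at hq hq2
      omega
  have h4 := harm_le_log w
  have : Real.log 2 ≤ 1 := by linarith [Real.log_two_lt_d9]
  linarith

lemma SS_upper (w y : ℕ) : SS (QQ w y) ≤ 1 + Real.log y := by
  refine le_trans ?_ (harm_le_log y)
  apply Finset.sum_le_sum_of_subset_of_nonneg
  · intro q hq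
    simp only [QQ, Finset.mem_filter, Finset.mem_Icc, Finset.mem_Ioc] at hq ⊢
    omega
  · intro _ _ _; positivity

lemma sum_sq_QQ (w y : ℕ) (hw : 1 ≤ w) : ∑ q ∈ QQ w y, (1 : ℝ) / (q : ℝ) ^ 2 ≤ 1 / w := by
  rcases le_total w y with h | h
  · have h1 := sum_Ioc_inv_sq_le_sub (α := ℝ) (by omega : w ≠ 0) h
    calc _ ≤ ∑ q ∈ Ioc w y, (1 : ℝ) / (q : ℝ) ^ 2 :=
          Finset.sum_le_sum_of_subset_of_nonneg (Finset.filter_subset _ _) (fun _ _ _ => by positivity)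
      _ ≤ _ := by
          simp only [one_div]
          have : (0 : ℝ) ≤ (y : ℝ)⁻¹ := by positivity
          linarith
  · have : QQ w y = ∅ := by
      unfold QQ; rw [Finset.Ioc_eq_empty (by omega)]; simp
    rw [this]; simp

lemma dyadic : ∃ C : ℝ, 0 < C ∧ ∀ (Q : Finset ℕ) (_ : ∀ q ∈ Q, q.Prime) (X u : ℕ) (_ : 2 ≤ u) (M : ℕ) (_ : 2 ^ M * u ≤ X),
    ∑ d ∈ Ico u (2 ^ M * u), (1 / 2 : ℝ) ^ gq Q d * (sg d / d) ≤ M * (C * HH Q X / Real.log u) := by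
  obtain ⟨C, hC, hht⟩ := ht_two
  refine ⟨2 * C, by positivity, fun Q hQ X u hu M => ?_⟩
  have hur : (2 : ℝ) ≤ u := by exact_mod_cast hu
  have hlu : 0 < Real.log u := Real.log_pos (by linarith)
  induction M with
  | zero => intro _; simp
  | succ M ih =>
    intro hM
    have hpow : 2 ^ (M + 1) * u = 2 * (2 ^ M * u) := by ring
    set v := 2 ^ M * u with hv
    have huv : u ≤ v := Nat.le_mul_of_pos_left u (by positivity)
    have h1 := ih (by omega)
    rw [hpow, ← Finset.sum_Ico_consecutive _ huv (by omega : v ≤ 2 * v)]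
    have h2 : ∑ d ∈ Ico v (2 * v), (1 / 2 : ℝ) ^ gq Q d * (sg d / d) ≤ 2 * C * HH Q X / Real.log u := by
      have h3 := hht Q hQ (2 * v) (by omega)
      have hvr : (0 : ℝ) < v := by
        have : 0 < v := by omega
        exact_mod_cast this
      calc _ ≤ ∑ d ∈ Ico v (2 * v), (1 / (v * Real.log u)) * ((1 / 2 : ℝ) ^ gq Q d * sg d * Real.log d) := by
            apply Finset.sum_le_sum
            intro d hd
            rw [Finset.mem_Ico] at hd
            have hdv : (v : ℝ) ≤ d := by exact_mod_cast hd.1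
            have hdu : (u : ℝ) ≤ d := by exact_mod_cast huv.trans hd.1
            have hld : Real.log u ≤ Real.log d := Real.log_le_log (by linarith) hdu
            have hs := sg_nonneg d
            have hd0 : (0 : ℝ) < d := by linarith
            have e : (1 / 2 : ℝ) ^ gq Q d * (sg d / d) = (1 / (d * Real.log d)) * ((1 / 2 : ℝ) ^ gq Q d * sg d * Real.log d) := by
              have : Real.log d ≠ 0 := by linarith
              field_simp
            rw [e]
            have : 0 ≤ Real.log d := by linarith
            gcongr
        _ ≤ (1 / (v * Real.log u)) * (C * (2 * v : ℕ) * HH Q (2 * v)) := by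
            rw [← Finset.mul_sum]
            gcongr
            refine le_trans ?_ h3
            apply Finset.sum_le_sum_of_subset_of_nonneg
            · intro d hd
              rw [Finset.mem_Ico] at hd
              rw [Finset.mem_Icc]
              omega
            · intro d _ _
              have := Real.log_natCast_nonneg d
              have := sg_nonneg d
              positivity
        _ ≤ (1 / (v * Real.log u)) * (C * (2 * v : ℕ) * HH Q X) := by
            gcongr
            exact HH_mono Q (by omega)
        _ = _ := by push_cast; field_simp
    push_cast
    linarith

lemma sg_sq_le (q : ℕ) (hq : q.Prime) : sg (q ^ 2) ≤ 4 := by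
  have h1 := sg_prime_mul q q hq hq.one_lt.le
  have h2 := sg_prime_mul q 1 hq le_rfl
  rw [mul_one, sg_one, mul_one] at h2
  have h3 : (1 : ℝ) / q ≤ 1 := by
    rw [div_le_one (by exact_mod_cast hq.pos)]; exact_mod_cast hq.one_lt.le
  have h4 : (0 : ℝ) ≤ 1 / q := by positivity
  rw [sq]
  have := sg_nonneg q
  nlinarith

lemma gq_split (Q : Finset ℕ) (d m n : ℕ) (h : d * m = n)
    (hsq : ∀ q ∈ Q, ¬ q ^ 2 ∣ n) : gq Q d + gq Q m ≤ gq Q n := by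
  classical
  unfold gq
  rw [← Finset.card_union_of_disjoint]
  · apply Finset.card_le_card
    intro q hq
    simp only [Finset.mem_union, Finset.mem_filter] at hq ⊢
    rcases hq with ⟨a, b⟩ | ⟨a, b⟩
    · exact ⟨a, h ▸ Dvd.dvd.mul_right b m⟩
    · exact ⟨a, h ▸ Dvd.dvd.mul_left b d⟩
  · rw [Finset.disjoint_left]
    intro q hq hq2
    simp only [Finset.mem_filter] at hq hq2
    apply hsq q hq.1
    rw [← h, sq]
    exact mul_dvd_mul hq.2 hq2.2

lemma combo (P : Finset ℕ) (n : ℕ → ℕ) (B D : ℝ) (hB : 0 ≤ B)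
    (hsv : ∀ d : ℕ, 1 ≤ d → (d : ℝ) ≤ D → ((P.filter (fun p => d ∣ n p)).card : ℝ) ≤ B * (sg d / d))
    (w y : ℕ) (hw : 50 ≤ w) (k : ℕ) (hy2 : (y : ℝ) ^ 2 ≤ D) (hyk : (y : ℝ) ^ k ≤ D)
    (hS0 : 0 < SS (QQ w y)) (hSk : 10 * (k : ℝ) ≤ SS (QQ w y))
    (u M : ℕ) (hu : 2 ≤ u) (hD : ((2 ^ M * u : ℕ) : ℝ) ≤ D) (K : ℝ)
    (hK : ∑ d ∈ Ico u (2 ^ M * u), (1 / 2 : ℝ) ^ gq (QQ w y) d * (sg d / d) ≤ K) (R : Finset ℕ) (hRP : R ⊆ P)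
    (hR : ∀ p ∈ R, ∃ d m, d * m = n p ∧ u ≤ d ∧ u ≤ m ∧ d < 2 ^ M * u ∧ m < 2 ^ M * u) :
    (R.card : ℝ) ≤
      B * (4 / w + (1.05 / 1.1) ^ k + (2 : ℝ) ^ (0.6 * SS (QQ w y)) * K) := by
  classical
  set Q := QQ w y with hQdef
  have hQ : ∀ q ∈ Q, q.Prime ∧ w < q ∧ q ≤ y := by
    intro q hq
    simp only [hQdef, QQ, Finset.mem_filter, Finset.mem_Ioc] at hq
    exact ⟨hq.2, hq.1.1, hq.1.2⟩
  set A2 := Q.biUnion (fun q => P.filter (fun p => q ^ 2 ∣ n p)) with hA2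
  set A3 := P.filter (fun p => 1.2 * SS Q < gq Q (n p)) with hA3
  set A4 := ((Ico u (2 ^ M * u)).filter (fun d => (gq Q d : ℝ) ≤ 0.6 * SS Q)).biUnion
    (fun d => P.filter (fun p => d ∣ n p)) with hA4
  have hsub : R ⊆ (A2 ∪ A3) ∪ A4 := by
    intro p hp
    obtain ⟨d, m, hdm, h1, h2, h3, h4⟩ := hR p hp
    have hpP := hRP hp
    by_cases c2 : p ∈ A2
    · simp [c2]
    by_cases c3 : p ∈ A3
    · simp [c3]
    apply Finset.mem_union_right
    have hsq : ∀ q ∈ Q, ¬ q ^ 2 ∣ n p := by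
      intro q hq hd
      apply c2
      rw [hA2, Finset.mem_biUnion]
      exact ⟨q, hq, Finset.mem_filter.2 ⟨hpP, hd⟩⟩
    have hg : (gq Q (n p) : ℝ) ≤ 1.2 * SS Q := by
      by_contra hc
      exact c3 (Finset.mem_filter.2 ⟨hpP, not_le.1 hc⟩)
    have hspl : ((gq Q d : ℝ) + gq Q m) ≤ gq Q (n p) := by
      exact_mod_cast gq_split Q d m _ hdm hsq
    rw [hA4, Finset.mem_biUnion]
    by_cases hgd : (gq Q d : ℝ) ≤ 0.6 * SS Q
    · exact ⟨d, Finset.mem_filter.2 ⟨Finset.mem_Ico.2 ⟨h1, h3⟩, hgd⟩, Finset.mem_filter.2 ⟨hpP, ⟨m, hdm.symm⟩⟩⟩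
    · refine ⟨m, Finset.mem_filter.2 ⟨Finset.mem_Ico.2 ⟨h2, h4⟩, by linarith⟩, Finset.mem_filter.2 ⟨hpP, ⟨d, by rw [mul_comm]; exact hdm.symm⟩⟩⟩
  have c2 : (A2.card : ℝ) ≤ B * (4 / w) := by
    calc (A2.card : ℝ) ≤ ∑ q ∈ Q, ((P.filter (fun p => q ^ 2 ∣ n p)).card : ℝ) := by
          exact_mod_cast Finset.card_biUnion_le
      _ ≤ ∑ q ∈ Q, (4 * B) * (1 / (q : ℝ) ^ 2) := by
          apply Finset.sum_le_sum
          intro q hq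
          have hq' := hQ q hq
          have hqy : (q : ℝ) ≤ y := by exact_mod_cast hq'.2.2
          have := hsv (q ^ 2) (Nat.one_le_pow _ _ hq'.1.pos) (by
            push_cast
            exact le_trans (by gcongr) hy2)
          refine this.trans ?_
          have h4 := sg_sq_le q hq'.1
          push_cast
          calc B * (sg (q ^ 2) / (q : ℝ) ^ 2) ≤ B * (4 / (q : ℝ) ^ 2) := by gcongr
            _ = _ := by ring
      _ ≤ (4 * B) * (1 / w) := by
          rw [← Finset.mul_sum]
          gcongr
          exact sum_sq_QQ w y (by omega)
      _ = _ := by ring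
  have c3 : (A3.card : ℝ) ≤ B * (1.05 / 1.1) ^ k := by
    apply moment k Q (fun q hq => (hQ q hq).1) (fun q hq => by have := hQ q hq; omega) P n B hB hS0 hSk
    intro E hE
    rw [Finset.mem_powersetCard] at hE
    apply hsv
    · apply Nat.one_le_iff_ne_zero.2
      rw [Finset.prod_ne_zero_iff]
      intro q hq
      exact (hQ q (hE.1 hq)).1.ne_zero
    · refine le_trans ?_ hyk
      push_cast
      rw [← hE.2]
      calc ∏ q ∈ E, (q : ℝ) ≤ ∏ _q ∈ E, (y : ℝ) := by
            apply Finset.prod_le_prod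
            · intro _ _; positivity
            · intro q hq; exact_mod_cast (hQ q (hE.1 hq)).2.2
        _ = _ := by simp
  have c4 : (A4.card : ℝ) ≤ B * ((2 : ℝ) ^ (0.6 * SS Q) * K) := by
    calc (A4.card : ℝ) ≤ ∑ d ∈ (Ico u (2 ^ M * u)).filter (fun d => (gq Q d : ℝ) ≤ 0.6 * SS Q),
            ((P.filter (fun p => d ∣ n p)).card : ℝ) := by
          exact_mod_cast Finset.card_biUnion_le
      _ ≤ ∑ d ∈ (Ico u (2 ^ M * u)).filter (fun d => (gq Q d : ℝ) ≤ 0.6 * SS Q),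
            (B * (2 : ℝ) ^ (0.6 * SS Q)) * ((1 / 2 : ℝ) ^ gq Q d * (sg d / d)) := by
          apply Finset.sum_le_sum
          intro d hd
          rw [Finset.mem_filter, Finset.mem_Ico] at hd
          have hd0 : 1 ≤ d := by omega
          have hdD : (d : ℝ) ≤ D := le_trans (by exact_mod_cast hd.1.2.le) hD
          refine (hsv d hd0 hdD).trans ?_
          have hs := sg_nonneg d
          have h1 : (1 : ℝ) ≤ (2 : ℝ) ^ (0.6 * SS Q) * (1 / 2 : ℝ) ^ gq Q d := by
            rw [one_div, inv_pow, ← Real.rpow_natCast, ← div_eq_mul_inv, one_le_div (by positivity)]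
            exact Real.rpow_le_rpow_of_exponent_le (by norm_num) hd.2
          calc B * (sg d / d) = B * (1 * (sg d / d)) := by ring
            _ ≤ B * (((2 : ℝ) ^ (0.6 * SS Q) * (1 / 2 : ℝ) ^ gq Q d) * (sg d / d)) := by gcongr
            _ = _ := by ring
      _ ≤ (B * (2 : ℝ) ^ (0.6 * SS Q)) * ∑ d ∈ Ico u (2 ^ M * u), ((1 / 2 : ℝ) ^ gq Q d * (sg d / d)) := by
          rw [← Finset.mul_sum]
          gcongr
          · intro d _ _
            have := sg_nonneg d
            positivity
          · exact Finset.filter_subset _ _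
      _ ≤ (B * (2 : ℝ) ^ (0.6 * SS Q)) * K := by gcongr
      _ = _ := by ring
  have hcard : (R.card : ℝ) ≤ A2.card + A3.card + A4.card := by
    have h1 := (Finset.card_le_card hsub).trans (Finset.card_union_le _ _)
    have h2 := Finset.card_union_le A2 A3
    have : R.card ≤ A2.card + A3.card + A4.card := by omega
    exact_mod_cast this
  linarith

lemma count_bad (N : ℕ) (hN : 2 ≤ N) (D : ℝ) (hDdef : D = Real.exp (0.6 * Real.log N))
    (w y : ℕ) (hw : 50 ≤ w) (k : ℕ) (hy2 : (y : ℝ) ^ 2 ≤ D) (hyk : (y : ℝ) ^ k ≤ D)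
    (hS0 : 0 < SS (QQ w y)) (hSk : 10 * (k : ℝ) ≤ SS (QQ w y))
    (u M : ℕ) (hu : 2 ≤ u) (hD : ((2 ^ M * u : ℕ) : ℝ) ≤ D) (K : ℝ)
    (hK : ∑ d ∈ Ico u (2 ^ M * u), (1 / 2 : ℝ) ^ gq (QQ w y) d * (sg d / d) ≤ K)
    (T N1 : ℕ) (Z : ℝ) (huT : u ≤ T) (hZu : Z ≤ ((2 ^ M * u : ℕ) : ℝ)) (huZ : u * Z ≤ N1)
    (hNT : N + 1 < (T + 1) * (2 ^ M * u)) (Bd : Finset ℕ)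
    (hBd : ∀ p ∈ Bd, p ≤ N ∧ p.Prime ∧ (orderOfAppearance p : ℝ) < Z) :
    (Bd.card : ℝ) ≤ 1 + N1 + T * T + 2 * ((100 * ((N : ℝ) / Real.log N)) *
      (4 / w + (1.05 / 1.1) ^ k + (2 : ℝ) ^ (0.6 * SS (QQ w y)) * K)) := by
  classical
  have hB : 0 ≤ 100 * ((N : ℝ) / Real.log N) := by
    have := Real.log_natCast_nonneg N
    positivity
  set P := (Icc 1 N).filter Nat.Prime with hP
  set G := Bd.filter (fun p => p ≠ 5 ∧ N1 < p ∧ T < orderOfAppearance p) with hG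
  set R1 := G.filter (fun p => orderOfAppearance p ∣ p - 1) with hR1
  set R2 := G.filter (fun p => orderOfAppearance p ∣ p + 1) with hR2
  have hGm : ∀ p ∈ G, p ≤ N ∧ p.Prime ∧ (orderOfAppearance p : ℝ) < Z ∧ p ≠ 5 ∧ N1 < p ∧ T < orderOfAppearance p := by
    intro p hp
    rw [hG, Finset.mem_filter] at hp
    have := hBd p hp.1
    tauto
  have key : ∀ p ∈ G, ∀ n : ℕ, p - 1 ≤ n → n ≤ p + 1 → orderOfAppearance p ∣ n →
      ∃ d m, d * m = n ∧ u ≤ d ∧ u ≤ m ∧ d < 2 ^ M * u ∧ m < 2 ^ M * u := by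
    intro p hp n h1 h2 hdv
    obtain ⟨a1, a2, a3, a4, a5, a6⟩ := hGm p hp
    obtain ⟨m, hm⟩ := hdv
    refine ⟨orderOfAppearance p, m, hm.symm, by omega, ?_, ?_, ?_⟩
    · by_contra hc
      push Not at hc
      have hN1n : N1 ≤ n := by omega
      have e1 : (N1 : ℝ) ≤ orderOfAppearance p * m := by rw [hm] at hN1n; exact_mod_cast hN1n
      have e2 : (m : ℝ) + 1 ≤ u := by exact_mod_cast hc
      have e3 : (0 : ℝ) < orderOfAppearance p := by
        have : 0 < orderOfAppearance p := by omega
        exact_mod_cast this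
      have e4 : (0 : ℝ) ≤ m := by positivity
      nlinarith
    · have : (orderOfAppearance p : ℝ) < ((2 ^ M * u : ℕ) : ℝ) := a3.trans_le hZu
      exact_mod_cast this
    · by_contra hc
      push Not at hc
      have : (T + 1) * (2 ^ M * u) ≤ orderOfAppearance p * m := Nat.mul_le_mul a6 hc
      omega
  have hGP : G ⊆ P := by
    intro p hp
    have := hGm p hp
    rw [hP, Finset.mem_filter, Finset.mem_Icc]
    exact ⟨⟨this.2.1.pos, this.1⟩, this.2.1⟩
  have c1 := combo P (fun p => p - 1) (100 * ((N : ℝ) / Real.log N)) D hB (by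
    intro d hd hdD
    have := sieve_final N hN d hd (hDdef ▸ hdD) 1 (by norm_num)
    refine le_trans ?_ this
    norm_cast
    apply Finset.card_le_card
    intro p hp
    simp only [hP, Finset.mem_filter] at hp ⊢
    refine ⟨hp.1.1, hp.1.2, ?_⟩
    have h1 : 1 ≤ p := hp.1.2.pos
    have := Int.natCast_dvd_natCast.2 hp.2
    push_cast [h1] at this
    exact this) w y hw k hy2 hyk hS0 hSk u M hu hD K hK R1 ((Finset.filter_subset _ _).trans hGP) (by
      intro p hp
      rw [hR1, Finset.mem_filter] at hp
      exact key p hp.1 (p - 1) le_rfl (by omega) hp.2)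
  have c2 := combo P (fun p => p + 1) (100 * ((N : ℝ) / Real.log N)) D hB (by
    intro d hd hdD
    have := sieve_final N hN d hd (hDdef ▸ hdD) (-1) (by norm_num)
    refine le_trans ?_ this
    norm_cast
    apply Finset.card_le_card
    intro p hp
    simp only [hP, Finset.mem_filter] at hp ⊢
    refine ⟨hp.1.1, hp.1.2, ?_⟩
    have := Int.natCast_dvd_natCast.2 hp.2
    push_cast at this
    simpa using this) w y hw k hy2 hyk hS0 hSk u M hu hD K hK R2 ((Finset.filter_subset _ _).trans hGP) (by
      intro p hp
      rw [hR2, Finset.mem_filter] at hp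
      exact key p hp.1 (p + 1) (by omega) le_rfl hp.2)
  set S3 := (Icc 1 N).filter (fun p : ℕ => p.Prime ∧ p ≠ 5 ∧ orderOfAppearance p ≤ T) with hS3
  have c3 : S3.card ≤ T * T := by convert card_small_z N T
  have hsub : Bd ⊆ {5} ∪ Icc 1 N1 ∪ S3 ∪ R1 ∪ R2 := by
    intro p hp
    obtain ⟨b1, b2, b3⟩ := hBd p hp
    simp only [Finset.mem_union, Finset.mem_singleton]
    by_cases h5 : p = 5
    · simp [h5]
    by_cases hp1 : p ≤ N1
    · left; left; left; right; rw [Finset.mem_Icc]; exact ⟨b2.pos, hp1⟩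
    by_cases hpT : orderOfAppearance p ≤ T
    · left; left; right; rw [hS3, Finset.mem_filter, Finset.mem_Icc]; exact ⟨⟨b2.pos, b1⟩, b2, h5, hpT⟩
    have hpG : p ∈ G := by
      rw [hG, Finset.mem_filter]; exact ⟨hp, h5, by omega, by omega⟩
    rcases (z_spec p b2 h5).2.2 with h | h
    · left; right; rw [hR1, Finset.mem_filter]; exact ⟨hpG, h⟩
    · right; rw [hR2, Finset.mem_filter]; exact ⟨hpG, h⟩
  have hc : Bd.card ≤ 1 + N1 + T * T + R1.card + R2.card := by
    have h0 := Finset.card_le_card hsub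
    have h1 := Finset.card_union_le ({5} ∪ Icc 1 N1 ∪ S3 ∪ R1) R2
    have h2 := Finset.card_union_le ({5} ∪ Icc 1 N1 ∪ S3) R1
    have h3 := Finset.card_union_le ({5} ∪ Icc 1 N1) S3
    have h4 := Finset.card_union_le {5} (Icc 1 N1)
    simp only [Finset.card_singleton, Nat.card_Icc] at h4
    omega
  have hc' : (Bd.card : ℝ) ≤ 1 + N1 + T * T + R1.card + R2.card := by exact_mod_cast hc
  linarith

lemma ev_cond (ε C : ℝ) (hε : 0 < ε) (k : ℕ) : ∀ᶠ L : ℝ in atTop,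
    100 ≤ L ∧ 52 ≤ L ^ (1 / 16 : ℝ) ∧ 12800 / ε + 1 ≤ L ^ (1 / 16 : ℝ) ∧ 32 ≤ Real.log L ∧
    80 * (k : ℝ) ≤ Real.log L ∧ (k : ℝ) + 4 ≤ L ^ (1 / 4 : ℝ) ∧
    100 * (L ^ (1 / 1000 : ℝ) + 1) ≤ L ∧ L * Real.exp (-L ^ (1 / 1000 : ℝ)) ≤ 1 / 4 ∧
    L * Real.exp (-L ^ (1 / 1000 : ℝ)) ≤ ε / 48 ∧ 1 / L ≤ ε / 16 ∧
    43200 * C * L ^ (-(0.007 : ℝ)) ≤ ε / 16 := by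
  have h16 : Tendsto (fun L : ℝ => L ^ (1 / 16 : ℝ)) atTop atTop := tendsto_rpow_atTop (by norm_num)
  have h4 : Tendsto (fun L : ℝ => L ^ (1 / 4 : ℝ)) atTop atTop := tendsto_rpow_atTop (by norm_num)
  have ht : Tendsto (fun L : ℝ => L ^ (1 / 1000 : ℝ)) atTop atTop := tendsto_rpow_atTop (by norm_num)
  have hlog := Real.tendsto_log_atTop
  have hexp : Tendsto (fun L : ℝ => L * Real.exp (-L ^ (1 / 1000 : ℝ))) atTop (nhds 0) := by
    have h := (Real.tendsto_pow_mul_exp_neg_atTop_nhds_zero 1000).comp ht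
    refine h.congr' ?_
    filter_upwards [eventually_ge_atTop (0 : ℝ)] with L hL
    simp only [Function.comp]
    rw [← Real.rpow_natCast, ← Real.rpow_mul hL]
    norm_num
  have hinv : Tendsto (fun L : ℝ => 1 / L) atTop (nhds 0) := by
    simpa using tendsto_inv_atTop_zero (𝕜 := ℝ)
  have hneg : Tendsto (fun L : ℝ => 43200 * C * L ^ (-(0.007 : ℝ))) atTop (nhds 0) := by
    have := (tendsto_rpow_neg_atTop (by norm_num : (0 : ℝ) < 0.007)).const_mul (43200 * C)
    simpa using this
  have hlin : ∀ᶠ L : ℝ in atTop, 100 * (L ^ (1 / 1000 : ℝ) + 1) ≤ L := by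
    filter_upwards [ht.eventually_ge_atTop 200, eventually_ge_atTop (1 : ℝ)] with L hL hL1
    have e : (L ^ (1 / 1000 : ℝ)) ^ 2 ≤ L := by
      rw [← Real.rpow_natCast, ← Real.rpow_mul (by linarith)]
      calc L ^ (1 / 1000 * ((2 : ℕ) : ℝ)) ≤ L ^ (1 : ℝ) := Real.rpow_le_rpow_of_exponent_le hL1 (by norm_num)
        _ = L := Real.rpow_one L
    nlinarith
  filter_upwards [eventually_ge_atTop (100 : ℝ), h16.eventually_ge_atTop 52, h16.eventually_ge_atTop (12800 / ε + 1),
    hlog.eventually_ge_atTop 32, hlog.eventually_ge_atTop (80 * (k : ℝ)), h4.eventually_ge_atTop ((k : ℝ) + 4), hlin,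
    hexp.eventually_le_const (by norm_num : (0 : ℝ) < 1 / 4), hexp.eventually_le_const (by positivity : (0 : ℝ) < ε / 48),
    hinv.eventually_le_const (by positivity : (0 : ℝ) < ε / 16), hneg.eventually_le_const (by positivity : (0 : ℝ) < ε / 16)]
    with L a b c d e f g h i j l
  exact ⟨a, b, c, d, e, f, g, h, i, j, l⟩

lemma pi_lower (N : ℕ) (hL : 100 ≤ Real.log N) : (N : ℝ) / (2 * Real.log N) ≤ N.primeCounting := by
  refine le_trans ?_ (Chebyshev.pi_ge N)
  have hN : (0 : ℝ) < N := by
    rcases Nat.eq_zero_or_pos N with h | h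
    · subst h; norm_num at hL
    · exact_mod_cast h
  have hN1 : (1 : ℝ) ≤ N := by exact_mod_cast (by exact_mod_cast hN : 0 < N)
  have h1 : Real.log (N + 1) ≤ Real.log N + 1 := by
    calc Real.log (N + 1) ≤ Real.log (2 * N) := Real.log_le_log (by linarith) (by linarith)
      _ = Real.log 2 + Real.log N := Real.log_mul (by norm_num) hN.ne'
      _ ≤ _ := by linarith [Real.log_two_lt_d9]
  have h2 := Real.quadratic_le_exp_of_nonneg (by linarith : 0 ≤ Real.log N)
  rw [Real.exp_log hN] at h2
  have hl2 := Real.log_two_gt_d9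
  rw [div_le_div_iff₀ (by linarith) (by linarith)]
  have : (N : ℝ) ≤ 2 * (N * Real.log 2 - Real.log (N + 1)) := by nlinarith
  nlinarith

set_option maxHeartbeats 2000000 in
lemma main_step (ε C : ℝ) (hε : 0 < ε) (hC : 0 < C)
    (hdy : ∀ (Q : Finset ℕ) (_ : ∀ q ∈ Q, q.Prime) (X u : ℕ) (_ : 2 ≤ u) (M : ℕ) (_ : 2 ^ M * u ≤ X),
      ∑ d ∈ Ico u (2 ^ M * u), (1 / 2 : ℝ) ^ gq Q d * (sg d / d) ≤ M * (C * HH Q X / Real.log u))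
    (k : ℕ) (hk : 200 * (1.05 / 1.1 : ℝ) ^ k ≤ ε / 16) (N : ℕ) (L : ℝ) (hLdef : L = Real.log N)
    (h : 100 ≤ L ∧ 52 ≤ L ^ (1 / 16 : ℝ) ∧ 12800 / ε + 1 ≤ L ^ (1 / 16 : ℝ) ∧ 32 ≤ Real.log L ∧
    80 * (k : ℝ) ≤ Real.log L ∧ (k : ℝ) + 4 ≤ L ^ (1 / 4 : ℝ) ∧
    100 * (L ^ (1 / 1000 : ℝ) + 1) ≤ L ∧ L * Real.exp (-L ^ (1 / 1000 : ℝ)) ≤ 1 / 4 ∧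
    L * Real.exp (-L ^ (1 / 1000 : ℝ)) ≤ ε / 48 ∧ 1 / L ≤ ε / 16 ∧
    43200 * C * L ^ (-(0.007 : ℝ)) ≤ ε / 16) (Bd : Finset ℕ)
    (hBd : ∀ p ∈ Bd, p ≤ N ∧ p.Prime ∧ (orderOfAppearance p : ℝ) < Real.exp (L / 2 + L ^ (1 / 1000 : ℝ))) :
    (Bd.card : ℝ) ≤ ε * N.primeCounting := by
  obtain ⟨a1, a2, a3, a4, a5, a6, a7, a8, a9, a10, a11⟩ := h
  have hNpos : (0 : ℝ) < N := by
    rcases Nat.eq_zero_or_pos N with h | h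
    · subst h; norm_num at hLdef; linarith
    · exact_mod_cast h
  have hNe : (N : ℝ) = Real.exp L := by rw [hLdef, Real.exp_log hNpos]
  have hpi := pi_lower N (hLdef ▸ a1)
  rw [← hLdef] at hpi
  have hL0 : 0 < L := by linarith
  set t := L ^ (1 / 1000 : ℝ) with ht
  set l := L ^ (1 / 4 : ℝ) with hl
  set s := L ^ (1 / 16 : ℝ) with hs
  have ht1 : 1 ≤ t := Real.one_le_rpow (by linarith) (by norm_num)
  have hl4 : l ^ 4 = L := by
    rw [hl, ← Real.rpow_natCast, ← Real.rpow_mul hL0.le]; norm_num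
  have hk0 : (0 : ℝ) ≤ k := by positivity
  have hll : 4 ≤ l := by linarith
  have hsl : s ≤ l := Real.rpow_le_rpow_of_exponent_le (by linarith) (by norm_num)
  have hlogs : Real.log s = 1 / 16 * Real.log L := Real.log_rpow hL0 _
  have hlogl : Real.log l = 1 / 4 * Real.log L := Real.log_rpow hL0 _
  have hl3 : l * 64 ≤ L := by rw [← hl4]; nlinarith [pow_le_pow_left₀ (by norm_num) hll 3]
  have hel := Real.add_one_le_exp l
  have het : 4 * L ≤ Real.exp t := by
    rw [Real.exp_neg] at a8
    have := Real.exp_pos t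
    rw [← div_eq_mul_inv, div_le_iff₀ this] at a8
    linarith
  have hee : 4 * L ≤ Real.exp t * Real.exp t := by
    have h1 : 1 ≤ Real.exp t := by linarith
    have h2 := mul_le_mul_of_nonneg_left h1 (by linarith : 0 ≤ Real.exp t)
    linarith
  have hl2s : 16 * (l * l) ≤ L := by
    have h1 : 4 * 4 ≤ l * l := mul_le_mul hll hll (by norm_num) (by linarith)
    have h2 := mul_le_mul_of_nonneg_right h1 (by positivity : 0 ≤ l * l)
    have h3 : l ^ 4 = l * l * (l * l) := by ring
    linarith
  have hl2s' : 4 * l ≤ l * l := mul_le_mul_of_nonneg_right hll (by linarith)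
  set w := ⌊s⌋₊ with hw
  set y := ⌊Real.exp l⌋₊ with hy
  have hws : (w : ℝ) ≤ s := Nat.floor_le (by linarith)
  have hws' : s < w + 1 := Nat.lt_floor_add_one s
  have hye : (y : ℝ) ≤ Real.exp l := Nat.floor_le (Real.exp_pos _).le
  have hye' : Real.exp l < y + 1 := Nat.lt_floor_add_one _
  have hw50 : 50 ≤ w := Nat.le_floor (by push_cast; linarith)
  have hwy : w ≤ y := Nat.floor_le_floor (by linarith)
  have hy1 : (1 : ℝ) ≤ y := by exact_mod_cast (by omega : 1 ≤ y)
  have hw0 : (50 : ℝ) ≤ w := by exact_mod_cast hw50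
  set Q := QQ w y with hQ
  have hQm : ∀ q ∈ Q, q.Prime ∧ w < q ∧ q ≤ y := by
    intro q hq
    simp only [hQ, QQ, Finset.mem_filter, Finset.mem_Ioc] at hq
    exact ⟨hq.2, hq.1.1, hq.1.2⟩
  have hlogy : Real.log y ≤ l := by
    have := Real.log_le_log (by linarith) hye
    rwa [Real.log_exp] at this
  have hSl : 1 / 8 * Real.log L ≤ SS Q := by
    have h1 := SS_lower w y (by omega) hwy (by omega)
    have h2 : l ≤ Real.log (y + 1) := by
      rw [Real.le_log_iff_exp_le (by linarith)]; exact hye'.le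
    have h3 := Real.log_le_log (by linarith) h2
    have h4 := Real.log_le_log (by linarith) hws
    linarith
  have hSu : SS Q ≤ 1 + l := (SS_upper w y).trans (by linarith)
  -- the auxiliary parameters
  set u := ⌊Real.exp (L / 2 - 2 * t)⌋₊ with hu
  set M := ⌈8 * t⌉₊ with hM
  set T := ⌊Real.exp (L / 2) / L⌋₊ with hT
  set N1 := ⌈Real.exp (L - t)⌉₊ with hN1
  have hue : (u : ℝ) ≤ Real.exp (L / 2 - 2 * t) := Nat.floor_le (Real.exp_pos _).le
  have hv2 : 2 ≤ Real.exp (L / 2 - 2 * t) := by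
    have := Real.add_one_le_exp (L / 2 - 2 * t); linarith
  have hue' : Real.exp (L / 2 - 2 * t) / 2 ≤ u := by
    have : Real.exp (L / 2 - 2 * t) < u + 1 := Nat.lt_floor_add_one _
    linarith
  have hu2 : 2 ≤ u := Nat.le_floor (by push_cast; linarith)
  have hupos : (0 : ℝ) < u := by exact_mod_cast (by omega : 0 < u)
  have hlogu : L / 4 ≤ Real.log u := by
    rw [Real.le_log_iff_exp_le hupos]
    have e1 : Real.exp (L / 4) * 2 ≤ Real.exp (L / 2 - 2 * t) := by
      have : L / 2 - 2 * t = L / 4 + (L / 4 - 2 * t) := by ring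
      rw [this, Real.exp_add]
      have := Real.add_one_le_exp (L / 4 - 2 * t)
      gcongr
      linarith
    linarith
  have hMl : 8 * t ≤ M := Nat.le_ceil _
  have hMu : (M : ℝ) < 8 * t + 1 := Nat.ceil_lt_add_one (by linarith)
  have h2M : (2 : ℝ) ^ M = Real.exp (M * Real.log 2) := by
    rw [mul_comm, Real.exp_mul, Real.exp_log (by norm_num), Real.rpow_natCast]
  have hl2a := Real.log_two_gt_d9
  have hl2b := Real.log_two_lt_d9
  have h2Ml : Real.exp (5 * t) ≤ (2 : ℝ) ^ M := by
    rw [h2M]; apply Real.exp_le_exp.2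
    have e : 8 * t * 0.69 ≤ M * Real.log 2 := mul_le_mul hMl (by linarith) (by norm_num) (by linarith)
    linarith
  have h2Mu : (2 : ℝ) ^ M ≤ Real.exp (8 * t + 1) := by
    rw [h2M]; apply Real.exp_le_exp.2
    have e : (M : ℝ) * Real.log 2 ≤ M * 1 := by gcongr; linarith
    linarith
  have h2Mu6 : (2 : ℝ) ^ M * u ≤ Real.exp (0.6 * L) := by
    calc (2 : ℝ) ^ M * u ≤ Real.exp (8 * t + 1) * Real.exp (L / 2 - 2 * t) := by gcongr
      _ = Real.exp (L / 2 + 6 * t + 1) := by rw [← Real.exp_add]; congr 1; ring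
      _ ≤ _ := Real.exp_le_exp.2 (by linarith)
  have h2Mu3 : Real.exp (L / 2 + 3 * t) / 2 ≤ (2 : ℝ) ^ M * u := by
    calc Real.exp (L / 2 + 3 * t) / 2 = Real.exp (5 * t) * (Real.exp (L / 2 - 2 * t) / 2) := by
          rw [mul_div_assoc', ← Real.exp_add]; congr 2; ring
      _ ≤ _ := by gcongr
  have hMuN : 2 ^ M * u ≤ N := by
    have : (2 : ℝ) ^ M * u ≤ N := h2Mu6.trans (by rw [hNe]; exact Real.exp_le_exp.2 (by linarith))
    exact_mod_cast this
  have hN2 : 2 ≤ N := by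
    have : (2 : ℝ) ≤ N := by rw [hNe]; have := Real.add_one_le_exp L; linarith
    exact_mod_cast this
  have hHH := HH_le Q (fun q hq => (hQm q hq).1) (fun q hq => by have := hQm q hq; omega) N (by omega) l (by linarith)
    (fun q hq => by
      have h1 := hQm q hq
      refine le_trans (Real.log_le_log (by exact_mod_cast h1.1.pos) (by exact_mod_cast h1.2.2)) hlogy)
    (by rw [← hLdef, le_div_iff₀ (by linarith)]
        have e := mul_le_mul_of_nonneg_right hSu (by linarith : 0 ≤ l)
        have eqa : (2 * SS Q + 1) * l = 2 * (SS Q * l) + l := by ring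
        have eqb : (1 + l) * l = l + l * l := by ring
        linarith)
  rw [← hLdef] at hHH
  have hK := hdy Q (fun q hq => (hQm q hq).1) N u hu2 M hMuN
  have het2 : Real.exp (2 * t) = Real.exp t * Real.exp t := by rw [← Real.exp_add]; congr 1; ring
  have main := count_bad N hN2 (Real.exp (0.6 * Real.log N)) rfl w y hw50 k
    (by
      rw [← hLdef]
      calc (y : ℝ) ^ 2 ≤ (Real.exp l) ^ 2 := by gcongr
        _ = Real.exp (2 * l) := by rw [← Real.exp_nat_mul]; norm_num
        _ ≤ _ := Real.exp_le_exp.2 (by linarith))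
    (by
      rw [← hLdef]
      calc (y : ℝ) ^ k ≤ (Real.exp l) ^ k := by gcongr
        _ = Real.exp (k * l) := by rw [← Real.exp_nat_mul]
        _ ≤ _ := Real.exp_le_exp.2 (by
          have e1 : (k : ℝ) * l ≤ l * l := by gcongr; linarith
          linarith))
    (by linarith) (by linarith) u M hu2 (by rw [← hLdef]; push_cast; exact h2Mu6) _ hK T N1
    (Real.exp (L / 2 + t))
    (by
      apply Nat.floor_le_floor
      rw [le_div_iff₀ hL0]
      have e : L / 2 = (L / 2 - 2 * t) + 2 * t := by ring
      conv_rhs => rw [e, Real.exp_add]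
      gcongr
      rw [het2]; linarith)
    (by
      push_cast
      refine le_trans ?_ h2Mu3
      have e : L / 2 + 3 * t = (L / 2 + t) + 2 * t := by ring
      rw [e, Real.exp_add (L / 2 + t), het2]
      have := Real.exp_pos (L / 2 + t)
      rw [le_div_iff₀ (by norm_num)]
      gcongr
      linarith)
    (by
      calc (u : ℝ) * Real.exp (L / 2 + t) ≤ Real.exp (L / 2 - 2 * t) * Real.exp (L / 2 + t) := by gcongr
        _ = Real.exp (L - t) := by rw [← Real.exp_add]; congr 1; ring
        _ ≤ _ := Nat.le_ceil _)
    (by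
      have e1 : Real.exp (L / 2) / L < T + 1 := Nat.lt_floor_add_one _
      have e2 : (N : ℝ) + 1 < (T + 1) * (2 ^ M * u) := by
        calc (N : ℝ) + 1 ≤ 2 * Real.exp L := by
              rw [← hNe]; have : (2 : ℝ) ≤ N := by exact_mod_cast hN2
              linarith
          _ ≤ Real.exp (L / 2) / L * (Real.exp (L / 2 + 3 * t) / 2) := by
              have e3 : Real.exp (L / 2) / L * (Real.exp (L / 2 + 3 * t) / 2) = Real.exp L * (Real.exp (3 * t) / (2 * L)) := by
                have : Real.exp (L / 2) * Real.exp (L / 2 + 3 * t) = Real.exp L * Real.exp (3 * t) := by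
                  rw [← Real.exp_add, ← Real.exp_add]; congr 1; ring
                rw [div_mul_div_comm, this, mul_comm L 2, mul_div_assoc]
              rw [e3, mul_comm]
              gcongr
              rw [le_div_iff₀ (by linarith)]
              have : Real.exp t ≤ Real.exp (3 * t) := Real.exp_le_exp.2 (by linarith)
              linarith
          _ < (T + 1) * (Real.exp (L / 2 + 3 * t) / 2) := by gcongr
          _ ≤ _ := by gcongr
      exact_mod_cast e2)
    Bd hBd
  rw [← hLdef] at main
  set A := (N : ℝ) / L with hA
  have hA0 : 0 < A := by positivity
  -- bounds for the five terms
  have b1 : 1 + (N1 : ℝ) ≤ A * (ε / 16) := by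
    have e1 : (N1 : ℝ) < Real.exp (L - t) + 1 := Nat.ceil_lt_add_one (Real.exp_pos _).le
    have e2 : 1 ≤ Real.exp (L - t) := Real.one_le_exp (by linarith)
    have e3 : Real.exp (L - t) = A * (L * Real.exp (-t)) := by
      rw [sub_eq_add_neg, Real.exp_add, ← hNe, hA]; field_simp
    have e4 : A * (L * Real.exp (-t)) ≤ A * (ε / 48) := by gcongr
    linarith
  have b2 : (T : ℝ) * T ≤ A * (ε / 16) := by
    have e1 : (T : ℝ) ≤ Real.exp (L / 2) / L := Nat.floor_le (by positivity)
    calc (T : ℝ) * T ≤ (Real.exp (L / 2) / L) * (Real.exp (L / 2) / L) := by gcongr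
      _ = A * (1 / L) := by
          have : Real.exp (L / 2) * Real.exp (L / 2) = N := by rw [hNe, ← Real.exp_add]; congr 1; ring
          rw [hA, ← this]; field_simp
      _ ≤ _ := by gcongr
  have b3 : 200 * (4 / (w : ℝ)) ≤ ε / 16 := by
    have : 12800 / ε ≤ w := by linarith
    rw [div_le_iff₀ hε] at this
    rw [mul_div_assoc', div_le_iff₀ (by linarith)]
    linarith
  have b5 : 200 * ((2 : ℝ) ^ (0.6 * SS Q) * (M * (C * HH Q N / Real.log u))) ≤ ε / 16 := by
    refine le_trans ?_ a11
    have hS0 : 0 ≤ SS Q := by linarith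
    have f1 : (2 : ℝ) ^ (0.6 * SS Q) ≤ Real.exp (0.42 * SS Q) := by
      rw [Real.rpow_def_of_pos (by norm_num)]
      apply Real.exp_le_exp.2
      have e := mul_le_mul_of_nonneg_right hl2b.le hS0
      linarith
    have f2 : (M : ℝ) ≤ 9 * t := by linarith
    have f3 : HH Q N ≤ 6 * L * Real.exp (-(0.49 * SS Q)) := by
      refine hHH.trans ?_
      have e : 2 * (1 + 2 * L) ≤ 6 * L := by linarith
      exact mul_le_mul_of_nonneg_right e (Real.exp_pos _).le
    have f4 : Real.exp (-(0.07 * SS Q)) ≤ L ^ (-(0.008 : ℝ)) := by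
      rw [Real.rpow_def_of_pos hL0]
      apply Real.exp_le_exp.2; linarith
    calc _ ≤ 200 * (Real.exp (0.42 * SS Q) * ((9 * t) * (C * (6 * L * Real.exp (-(0.49 * SS Q))) / (L / 4)))) := by
          have := HH_nonneg Q N
          gcongr
      _ = 43200 * C * (t * (Real.exp (0.42 * SS Q) * Real.exp (-(0.49 * SS Q)))) := by field_simp; ring
      _ = 43200 * C * (t * Real.exp (-(0.07 * SS Q))) := by rw [← Real.exp_add]; congr 3; ring
      _ ≤ 43200 * C * (t * L ^ (-(0.008 : ℝ))) := by gcongr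
      _ = _ := by rw [ht, ← Real.rpow_add hL0]; norm_num
  have hpi' : A / 2 ≤ N.primeCounting := by
    refine le_trans (le_of_eq ?_) hpi
    rw [hA]; field_simp
  have fin : A * (200 * (4 / (w : ℝ)) + 200 * (1.05 / 1.1 : ℝ) ^ k + 200 * ((2 : ℝ) ^ (0.6 * SS Q) * (M * (C * HH Q N / Real.log u)))) ≤ A * (ε / 16 + ε / 16 + ε / 16) := by
    gcongr
  have : ε * (A / 2) ≤ ε * N.primeCounting := by gcongr
  have hAe := mul_pos hA0 hε
  have e1 : A * (ε / 16 + ε / 16 + ε / 16) = 3 / 16 * (A * ε) := by ring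
  have e2 : A * (ε / 16) = 1 / 16 * (A * ε) := by ring
  have e3 : ε * (A / 2) = 1 / 2 * (A * ε) := by ring
  rw [e1] at fin
  rw [e2] at b1 b2
  rw [e3] at this
  linarith

end Helpers

/-- **Lemma (order of appearance for almost all primes).**
There is `ρ > 0` such that for every `ε > 0` and all sufficiently large `N`,
the number of primes `p ≤ N` with `z(p) < N^{1/2}·e^{(log N)^ρ}` is at most
`ε·π(N)`. -/
theorem stmt_4 :
    ∃ ρ : ℝ, 0 < ρ ∧
      ∀ ε : ℝ, 0 < ε → ∃ N₀ : ℕ, ∀ N : ℕ, N₀ ≤ N →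
        ({p : ℕ | p ≤ N ∧ p.Prime ∧
            (orderOfAppearance p : ℝ) <
              (N : ℝ) ^ ((1 : ℝ) / 2) * Real.exp (Real.log N ^ ρ)}.ncard : ℝ)
          ≤ ε * (N.primeCounting : ℝ) := by
  obtain ⟨C, hC, hdy⟩ := dyadic
  refine ⟨1 / 1000, by norm_num, fun ε hε => ?_⟩
  obtain ⟨k, hk⟩ := exists_pow_lt_of_lt_one (by positivity : (0 : ℝ) < ε / 16 / 200) (by norm_num : (1.05 / 1.1 : ℝ) < 1)
  have hev := (Real.tendsto_log_atTop.comp tendsto_natCast_atTop_atTop).eventually (ev_cond ε C hε k)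
  obtain ⟨N₀, hN₀⟩ := Filter.eventually_atTop.1 hev
  refine ⟨N₀, fun N hN => ?_⟩
  have hc := hN₀ N hN
  simp only [Function.comp] at hc
  set A := {p : ℕ | p ≤ N ∧ p.Prime ∧ (orderOfAppearance p : ℝ) <
              (N : ℝ) ^ ((1 : ℝ) / 2) * Real.exp (Real.log N ^ (1 / 1000 : ℝ))} with hA
  have hfin : A.Finite := (Set.finite_Iic N).subset (fun p hp => hp.1)
  rw [Set.ncard_eq_toFinset_card A hfin]
  apply main_step ε C hε hC hdy k (by linarith [(lt_div_iff₀ (by norm_num : (0 : ℝ) < 200)).1 hk]) N _ rfl hc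
  intro p hp
  rw [Set.Finite.mem_toFinset] at hp
  obtain ⟨h1, h2, h3⟩ := hp
  refine ⟨h1, h2, ?_⟩
  have hN0 : (0 : ℝ) < N := by exact_mod_cast h2.pos.trans_le h1
  rw [Real.rpow_def_of_pos hN0, ← Real.exp_add] at h3
  convert h3 using 2
  ring
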